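/- arXiv:1502.03294 — 12 statements merged into one kernel-verified Lean document; each statement's English description precedes it below -/
import Mathlib

section
/- For every positive integer m, the polynomial L_1 · L_3 · L_5 ⋯ L_{2m+1} · S_{2m+1}(x) has only integer coefficients, where S_{2m+1}(x) is the rational-coefficient polynomial S_{2m+1}(x) = ∑_{s=0}^{m} x^{2s+1} ( ∑_{k=s}^{m} ((1+2k)/(1+2s)) · C(2m+1, m-k) · C(k+s, 2s) · (-5)^{s-m} / L_{2k+1} ) − ∑_{k=0}^{m} (-1)^{m-k} · C(2m+1, m-k) · (F_{2k+1} / L_{2k+1}) · 5^{-m}. -/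
open Polynomial

/-- The Lucas numbers: `L 0 = 2`, `L 1 = 1`, `L (n+2) = L (n+1) + L n`. -/
def lucas : ℕ → ℕ
  | 0 => 2
  | 1 => 1
  | n + 2 => lucas (n + 1) + lucas n

/-- The Ozeki–Prodinger polynomial `S_{2m+1}(x)`, with rational coefficients. -/
noncomputable def ozekiProdinger (m : ℕ) : Polynomial ℚ :=
  (∑ s ∈ Finset.range (m + 1),
      C (∑ k ∈ Finset.Icc s m,
          ((1 + 2 * k : ℚ) / (1 + 2 * s)) * (Nat.choose (2 * m + 1) (m - k)) *
            (Nat.choose (k + s) (2 * s)) * (-5 : ℚ) ^ ((s : ℤ) - (m : ℤ)) / (lucas (2 * k + 1))) *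
        X ^ (2 * s + 1)) -
    C (∑ k ∈ Finset.range (m + 1),
        (-1 : ℚ) ^ (m - k) * (Nat.choose (2 * m + 1) (m - k)) *
          ((Nat.fib (2 * k + 1) : ℚ) / (lucas (2 * k + 1))) * (5 : ℚ) ^ (-(m : ℤ)))

namespace OP

/-- The forward difference operator, iterated. -/
abbrev D {R : Type*} [CommRing R] (r : ℕ) (f : ℤ → R) : ℤ → R := (fwdDiff (1 : ℤ))^[r] f

lemma D_mul_dvd {R : Type*} [CommRing R] (p : R) (r : ℕ) :
    ∀ (a b c : ℕ → ℕ), (∀ i j, c (i + j) ≤ a i + b j) → ∀ f g : ℤ → R,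
      (∀ i ≤ r, ∀ n, p ^ a i ∣ D i f n) → (∀ i ≤ r, ∀ n, p ^ b i ∣ D i g n) →
      ∀ n, p ^ c r ∣ D r (fun k => f k * g k) n := by
  induction r with
  | zero =>
    intro a b c hc f g hf hg n
    have h1 := hf 0 le_rfl n
    have h2 := hg 0 le_rfl n
    have h3 := mul_dvd_mul h1 h2
    rw [← pow_add] at h3
    exact (pow_dvd_pow p (hc 0 0)).trans h3
  | succ r ih =>
    intro a b c hc f g hf hg n
    have key : fwdDiff (1 : ℤ) (fun k => f k * g k) =
        (fun k => fwdDiff 1 f k * g (k + 1)) + (fun k => f k * fwdDiff 1 g k) := by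
      funext k
      simp only [fwdDiff, Pi.add_apply]
      ring
    have e : D (r + 1) (fun k => f k * g k) n =
        D r (fun k => fwdDiff 1 f k * g (k + 1)) n + D r (fun k => f k * fwdDiff 1 g k) n := by
      simp only [D]
      rw [Function.iterate_succ_apply, key, fwdDiff_iter_add, Pi.add_apply]
    rw [e]
    apply dvd_add
    · refine ih (fun i => a (i + 1)) b (fun i => c (i + 1)) ?_ _ _ ?_ ?_ n
      · intro i j
        have := hc (i + 1) j
        rwa [show i + 1 + j = i + j + 1 by ring] at this
      · intro i hi n
        exact hf (i + 1) (by omega) n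
      · intro i hi n
        have := hg i (by omega) (n + 1)
        simp only [D]
        rwa [fwdDiff_iter_comp_add]
    · refine ih a (fun i => b (i + 1)) (fun i => c (i + 1)) ?_ _ _ ?_ ?_ n
      · intro i j
        exact hc i (j + 1)
      · intro i hi n
        exact hf i (by omega) n
      · intro i hi n
        exact hg (i + 1) (by omega) n

lemma D_neg {R : Type*} [CommRing R] (r : ℕ) (f : ℤ → R) (n : ℤ) :
    D r (fun k => -f k) n = - D r f n := by
  have : (fun k => - f k) = (-1 : ℤ) • f := by funext k; simp
  rw [this]
  simp only [D, fwdDiff_iter_const_smul]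
  simp

lemma D_inv_dvd {R : Type*} [CommRing R] (p : R) (f g : ℤ → R) (hfg : ∀ k, f k * g k = 1)
    (hf : ∀ i n, p ^ ((i + 1) / 2) ∣ D i f n) :
    ∀ r, ∀ i ≤ r, ∀ n, p ^ ((i + 1) / 2) ∣ D i g n := by
  intro r
  induction r with
  | zero =>
    intro i hi n
    obtain rfl : i = 0 := by omega
    simp
  | succ r ih =>
    intro i hi n
    rcases Nat.lt_or_ge i (r + 1) with h | h
    · exact ih i (by omega) n
    obtain rfl : i = r + 1 := by omega
    have key : fwdDiff (1 : ℤ) g = fun k => -(fwdDiff 1 f k * (g k * g (k + 1))) := by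
      funext k
      simp only [fwdDiff]
      linear_combination g k * hfg (k + 1) - g (k + 1) * (hfg k)
    have e : D (r + 1) g n = - D r (fun k => fwdDiff 1 f k * (g k * g (k + 1))) n := by
      rw [← D_neg]
      simp only [D]
      rw [Function.iterate_succ_apply, key]
    rw [e, dvd_neg]
    refine D_mul_dvd p r (fun i => (i + 1 + 1) / 2) (fun i => (i + 1) / 2)
      (fun i => (i + 1 + 1) / 2) ?_ _ _ ?_ ?_ n
    · intro i j
      try dsimp only
      omega
    · intro i hi n
      exact hf (i + 1) n
    · intro i hi n
      refine D_mul_dvd p i (fun i => (i + 1) / 2) (fun i => (i + 1) / 2)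
        (fun i => (i + 1) / 2) ?_ _ _ ?_ ?_ n
      · intro i j
        try dsimp only
        omega
      · intro j hj n
        exact ih j (by omega) n
      · intro j hj n
        have := ih j (by omega) (n + 1)
        simp only [D]
        rwa [fwdDiff_iter_comp_add]

lemma D_rec {R : Type*} [CommRing R] (u : ℤ → R) (hu : ∀ k, u (k + 2) = -3 * u (k + 1) - u k)
    (i : ℕ) (n : ℤ) : D (i + 2) u n = -5 * D i u (n + 1) := by
  have key : fwdDiff (1 : ℤ) (fwdDiff 1 u) = (-5 : R) • (fun k => u (k + 1)) := by
    funext k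
    simp only [fwdDiff, Pi.smul_apply, smul_eq_mul]
    have := hu k
    rw [show k + 1 + 1 = k + 2 by ring]
    linear_combination this
  simp only [D]
  rw [Function.iterate_succ_apply, Function.iterate_succ_apply, key, fwdDiff_iter_const_smul,
    Pi.smul_apply, fwdDiff_iter_comp_add, smul_eq_mul]

lemma D_rec_dvd {R : Type*} [CommRing R] (u : ℤ → R)
    (hu : ∀ k, u (k + 2) = -3 * u (k + 1) - u k) (i : ℕ) :
    (∀ n, (5 : R) ^ (i / 2) ∣ D i u n) ∧
    ((∀ n, (5 : R) ∣ D 1 u n) → ∀ n, (5 : R) ^ ((i + 1) / 2) ∣ D i u n) := by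
  induction i using Nat.twoStepInduction with
  | zero => simp
  | one => simp
  | more i h1 h2 =>
    have e1 : (i + 2) / 2 = i / 2 + 1 := by omega
    have e2 : (i + 2 + 1) / 2 = (i + 1) / 2 + 1 := by omega
    refine ⟨fun n => ?_, fun h n => ?_⟩
    · rw [D_rec u hu, e1, pow_succ, mul_comm]
      exact mul_dvd_mul (by simp) (h1.1 _)
    · rw [D_rec u hu, e2, pow_succ, mul_comm]
      exact mul_dvd_mul (by simp) (h1.2 h _)

/-- Symmetrization. -/
lemma D_odd {R : Type*} [CommRing R] (f : ℤ → R) (hf : ∀ k : ℕ, f (-(k : ℤ) - 1) = - f k) (m : ℕ) :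
    D (2 * m + 1) f (-(m : ℤ) - 1) =
      2 * ∑ k ∈ Finset.range (m + 1), (-1 : R) ^ (m - k) * ((2 * m + 1).choose (m - k)) * f k := by
  simp only [D]
  rw [fwdDiff_iter_eq_sum_shift, show 2 * m + 1 + 1 = (m + 1) + (m + 1) by ring,
    Finset.sum_range_add, show ∀ x : R, 2 * x = x + x from two_mul]
  congr 1
  · rw [← Finset.sum_range_reflect]
    apply Finset.sum_congr rfl
    intro k hk
    have hk' : k ≤ m := by simpa [Nat.lt_succ_iff] using hk
    have e1 : m + 1 - 1 - k = m - k := by omega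
    have e2 : (2 * m + 1 - (m - k)) = (m - k) + (2 * k + 1) := by omega
    have e3 : (-(m : ℤ) - 1 + (m - k : ℕ) • (1 : ℤ)) = -(k : ℤ) - 1 := by
      simp [Nat.cast_sub hk']; ring
    rw [e1, e3, hf, e2, pow_add, pow_succ (-1 : ℤ) (2 * k), pow_mul]
    simp
  · apply Finset.sum_congr rfl
    intro k hk
    have hk' : k ≤ m := by simpa [Nat.lt_succ_iff] using hk
    have e2 : (2 * m + 1 - (m + 1 + k)) = m - k := by omega
    have e3 : (-(m : ℤ) - 1 + (m + 1 + k : ℕ) • (1 : ℤ)) = k := by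
      simp; ring
    have e4 : (2 * m + 1).choose (m + 1 + k) = (2 * m + 1).choose (m - k) := by
      rw [← Nat.choose_symm (by omega : m + 1 + k ≤ 2 * m + 1), e2]
    rw [e2, e3, e4]
    simp

lemma two_cancel {R : Type*} [CommRing R] (e : ℕ) (x : R) (h : (5 : R) ^ e ∣ 2 * x) :
    (5 : R) ^ e ∣ x := by
  have : IsCoprime (5 : R) 2 := ⟨1, -2, by norm_num⟩
  exact (this.pow_left).dvd_of_dvd_mul_left h

/-- Extension to negative integers. -/
def ext (σ : ℤ) (u : ℕ → ℤ) : ℤ → ℤ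
  | Int.ofNat k => u k
  | Int.negSucc k => σ * u k

lemma ext_nat (σ : ℤ) (u : ℕ → ℤ) (k : ℕ) : ext σ u k = u k := rfl

lemma ext_neg (σ : ℤ) (u : ℕ → ℤ) (k : ℕ) : ext σ u (-(k : ℤ) - 1) = σ * u k := by
  have : (-(k : ℤ) - 1) = Int.negSucc k := by omega
  rw [this]; rfl

lemma ext_rec (σ : ℤ) (hσ : σ * σ = 1) (u : ℕ → ℤ) (hu : ∀ k, u (k + 2) = -3 * u (k + 1) - u k)
    (h0 : u 1 = -3 * u 0 - σ * u 0) (k : ℤ) :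
    ext σ u (k + 2) = -3 * ext σ u (k + 1) - ext σ u k := by
  rcases k with k | k
  · exact hu k
  · rcases k with _ | _ | k
    · change u 1 = -3 * u 0 - σ * u 0
      exact h0
    · change u 0 = -3 * (σ * u 0) - σ * u 1
      linear_combination σ * h0 - u 0 * hσ
    · have e1 : Int.negSucc (k + 1 + 1) + 2 = Int.negSucc k := by omega
      have e2 : Int.negSucc (k + 1 + 1) + 1 = Int.negSucc (k + 1) := by omega
      rw [e1, e2]
      change σ * u k = -3 * (σ * u (k + 1)) - σ * u (k + 2)
      rw [hu]; ring

/-- signed odd Lucas numbers -/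
def gl (k : ℕ) : ℤ := (-1) ^ k * lucas (2 * k + 1)
/-- signed odd Fibonacci numbers -/
def hf (k : ℕ) : ℤ := (-1) ^ k * Nat.fib (2 * k + 1)

lemma gl_rec (k : ℕ) : gl (k + 2) = -3 * gl (k + 1) - gl k := by
  have e1 : lucas (2 * (k + 2) + 1) = lucas (2 * k + 4) + lucas (2 * k + 3) := rfl
  have e2 : lucas (2 * k + 4) = lucas (2 * k + 3) + lucas (2 * k + 2) := rfl
  have e3 : lucas (2 * k + 3) = lucas (2 * k + 2) + lucas (2 * k + 1) := rfl
  have e4 : lucas (2 * (k + 1) + 1) = lucas (2 * k + 3) := rfl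
  simp only [gl]
  rw [e1, e4, e2, e3]
  push_cast
  ring

lemma hf_rec (k : ℕ) : hf (k + 2) = -3 * hf (k + 1) - hf k := by
  have e1 : Nat.fib (2 * (k + 2) + 1) = Nat.fib (2 * k + 3) + Nat.fib (2 * k + 4) :=
    Nat.fib_add_two (n := 2 * k + 3)
  have e2 : Nat.fib (2 * k + 4) = Nat.fib (2 * k + 2) + Nat.fib (2 * k + 3) :=
    Nat.fib_add_two (n := 2 * k + 2)
  have e3 : Nat.fib (2 * k + 3) = Nat.fib (2 * k + 1) + Nat.fib (2 * k + 2) :=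
    Nat.fib_add_two (n := 2 * k + 1)
  have e4 : Nat.fib (2 * (k + 1) + 1) = Nat.fib (2 * k + 3) := rfl
  simp only [hf]
  rw [e1, e4, e2, e3]
  push_cast
  ring

/-- the even extension of `gl` -/
def g : ℤ → ℤ := ext 1 gl
/-- the odd extension of `hf` -/
def h : ℤ → ℤ := ext (-1) hf

lemma g_rec (k : ℤ) : g (k + 2) = -3 * g (k + 1) - g k :=
  ext_rec 1 (by norm_num) gl gl_rec (by simp [gl, lucas]) k

lemma h_rec (k : ℤ) : h (k + 2) = -3 * h (k + 1) - h k :=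
  ext_rec (-1) (by norm_num) hf hf_rec (by simp [hf, Nat.fib]) k

lemma gl_mod (k : ℕ) : (5 : ℤ) ∣ gl k - 1 := by
  induction k using Nat.twoStepInduction with
  | zero => simp [gl, lucas]
  | one => simp [gl, lucas]
  | more k h1 h2 => rw [gl_rec]; omega

lemma g_mod (k : ℤ) : (5 : ℤ) ∣ g k - 1 := by
  rcases k with k | k
  · exact gl_mod k
  · change (5 : ℤ) ∣ 1 * gl k - 1
    rw [one_mul]; exact gl_mod k

instance : Fact (Nat.Prime 5) := ⟨by norm_num⟩

lemma g_unit (k : ℤ) : IsUnit ((g k : ℤ) : ℤ_[5]) := by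
  rw [PadicInt.isUnit_iff]
  by_contra hne
  have hlt := lt_of_le_of_ne (PadicInt.norm_le_one ((g k : ℤ) : ℤ_[5])) hne
  rw [PadicInt.norm_int_lt_one_iff_dvd] at hlt
  have := g_mod k
  push_cast at hlt
  omega

/-- the inverse of `g` in the 5-adic integers -/
noncomputable def H (k : ℤ) : ℤ_[5] := ((g_unit k).unit⁻¹ : (ℤ_[5])ˣ)

lemma g_mul_H (k : ℤ) : ((g k : ℤ) : ℤ_[5]) * H k = 1 := (g_unit k).mul_val_inv

lemma H_neg (k : ℕ) : H (-(k : ℤ) - 1) = H k := by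
  have h1 := g_mul_H (-(k : ℤ) - 1)
  have h2 := g_mul_H k
  have : g (-(k : ℤ) - 1) = g k := by
    unfold g; rw [ext_neg, ext_nat, one_mul]
  rw [this] at h1
  linear_combination H k * h1 - H (-(k : ℤ) - 1) * h2

lemma H_dvd (i : ℕ) (n : ℤ) : (5 : ℤ_[5]) ^ ((i + 1) / 2) ∣ D i H n := by
  refine D_inv_dvd 5 (fun k => ((g k : ℤ) : ℤ_[5])) H g_mul_H ?_ i i le_rfl n
  intro i n
  refine (D_rec_dvd _ ?_ i).2 ?_ n
  · intro k
    rw [g_rec]; push_cast; ring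
  · intro n
    have : (5 : ℤ) ∣ g (n + 1) - g n := by
      have h1 := g_mod n
      have h2 := g_mod (n + 1)
      omega
    have := (Int.castRingHom ℤ_[5]).map_dvd this
    change (5 : ℤ_[5]) ∣ ((g (n + 1) : ℤ) : ℤ_[5]) - ((g n : ℤ) : ℤ_[5])
    simpa using this

/-- constant coefficient -/
lemma const_dvd (m : ℕ) : (5 : ℤ_[5]) ^ m ∣
    ∑ k ∈ Finset.range (m + 1), (-1 : ℤ_[5]) ^ (m - k) * ((2 * m + 1).choose (m - k)) *
      (((h k : ℤ) : ℤ_[5]) * H k) := by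
  apply two_cancel
  rw [← D_odd (fun k => ((h k : ℤ) : ℤ_[5]) * H k)]
  · have := D_mul_dvd (5 : ℤ_[5]) (2 * m + 1) (fun i => i / 2) (fun i => (i + 1) / 2)
      (fun i => i / 2) (by intro i j; omega) (fun k => ((h k : ℤ) : ℤ_[5])) H
      (fun i _ n => (D_rec_dvd _ (by intro k; rw [h_rec]; push_cast; ring) i).1 n)
      (fun i _ n => H_dvd i n) (-(m : ℤ) - 1)
    try dsimp only at this
    rwa [show (2 * m + 1) / 2 = m by omega] at this
  · intro k
    rw [H_neg]
    have : h (-(k : ℤ) - 1) = - h k := by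
      unfold h; rw [ext_neg, ext_nat]; ring
    rw [this]; push_cast; ring

/-- The integer valued polynomial `(2k+1)/(2s+1) C(k+s,2s)`. -/
noncomputable def P (s : ℕ) (k : ℤ) : ℤ :=
  Ring.choose (k + (s + 1)) (2 * s + 1) + Ring.choose (k + s) (2 * s + 1)

lemma P_neg (s : ℕ) (k : ℤ) : P s (-k - 1) = - P s k := by
  unfold P
  have e1 : -k - 1 + ((s : ℤ) + 1) = -(k - s) := by ring
  have e2 : -k - 1 + (s : ℤ) = -(k + 1 - s) := by ring
  have e3 : Int.negOnePow ((2 * s + 1 : ℕ) : ℤ) = -1 := Int.negOnePow_odd _ (by simp)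
  rw [e1, e2, Ring.choose_neg, Ring.choose_neg, e3]
  have e4 : k - (s : ℤ) + ((2 * s + 1 : ℕ) : ℤ) - 1 = k + s := by push_cast; ring
  have e5 : k + 1 - (s : ℤ) + ((2 * s + 1 : ℕ) : ℤ) - 1 = k + (s + 1) := by push_cast; ring
  rw [e4, e5]
  simp only [Units.neg_smul, one_smul]
  ring

lemma choose_D {R : Type*} [CommRing R] (c : ℤ) (j : ℕ) :
    ∀ i, j < i → ∀ n, D i (fun k : ℤ => ((Ring.choose (k + c) j : ℤ) : R)) n = 0 := by
  induction j with
  | zero =>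
    intro i hi n
    obtain ⟨i, rfl⟩ : ∃ i', i = i' + 1 := ⟨i - 1, by omega⟩
    have hz : fwdDiff (1 : ℤ) (fun k : ℤ => ((Ring.choose (k + c) 0 : ℤ) : R)) =
        (0 : ℤ) • (fun k : ℤ => (0 : R)) := by
      funext k; simp [fwdDiff]
    simp only [D]
    rw [Function.iterate_succ_apply, hz, fwdDiff_iter_const_smul]
    simp
  | succ j ih =>
    intro i hi n
    obtain ⟨i, rfl⟩ : ∃ i', i = i' + 1 := ⟨i - 1, by omega⟩
    have hz : fwdDiff (1 : ℤ) (fun k : ℤ => ((Ring.choose (k + c) (j + 1) : ℤ) : R)) =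
        (fun k : ℤ => ((Ring.choose (k + c) j : ℤ) : R)) := by
      funext k
      simp only [fwdDiff]
      rw [show k + 1 + c = (k + c) + 1 by ring, Ring.choose_succ_succ]
      push_cast; ring
    simp only [D]
    rw [Function.iterate_succ_apply, hz]
    exact ih i (by omega) n

lemma P_D {R : Type*} [CommRing R] (s i : ℕ) (hi : 2 * s + 1 < i) (n : ℤ) :
    D i (fun k : ℤ => ((P s k : ℤ) : R)) n = 0 := by
  have : (fun k : ℤ => ((P s k : ℤ) : R)) =
      (fun k : ℤ => ((Ring.choose (k + (s + 1)) (2 * s + 1) : ℤ) : R)) +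
      (fun k : ℤ => ((Ring.choose (k + s) (2 * s + 1) : ℤ) : R)) := by
    funext k; simp [P]
  rw [this]
  have h1 := choose_D (R := R) ((s : ℤ) + 1) (2 * s + 1) i hi n
  have h2 := choose_D (R := R) (s : ℤ) (2 * s + 1) i hi n
  simp only [D] at h1 h2 ⊢
  rw [fwdDiff_iter_add, Pi.add_apply, h1, h2, add_zero]

lemma coeff_dvd (m s : ℕ) : (5 : ℤ_[5]) ^ (m - s) ∣
    ∑ k ∈ Finset.range (m + 1), (-1 : ℤ_[5]) ^ (m - k) * ((2 * m + 1).choose (m - k)) *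
      (((P s k : ℤ) : ℤ_[5]) * H k) := by
  apply two_cancel
  rw [← D_odd (fun k => ((P s k : ℤ) : ℤ_[5]) * H k)]
  · have := D_mul_dvd (5 : ℤ_[5]) (2 * m + 1) (fun i => if i ≤ 2 * s + 1 then 0 else i)
      (fun i => (i + 1) / 2)
      (fun i => (i - 2 * s) / 2) (by intro i j; split_ifs <;> omega)
      (fun k => ((P s k : ℤ) : ℤ_[5])) H
      (by
        intro i _ n
        try dsimp only
        split_ifs with hi
        · simp
        · rw [P_D s i (by omega)]; simp)
      (fun i _ n => H_dvd i n) (-(m : ℤ) - 1)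
    try dsimp only at this
    rwa [show (2 * m + 1 - 2 * s) / 2 = m - s by omega] at this
  · intro k
    rw [H_neg, P_neg]
    push_cast; ring

lemma P_nat (s k : ℕ) : ((P s k : ℤ) : ℚ) =
    ((1 + 2 * k : ℚ) / (1 + 2 * s)) * (Nat.choose (k + s) (2 * s)) := by
  have hP : P s k = (((k + s + 1).choose (2 * s + 1) + (k + s).choose (2 * s + 1) : ℕ) : ℤ) := by
    unfold P
    rw [show (k : ℤ) + ((s : ℤ) + 1) = ((k + s + 1 : ℕ) : ℤ) by push_cast; ring,
      show (k : ℤ) + (s : ℤ) = ((k + s : ℕ) : ℤ) by push_cast; ring,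
      Ring.choose_natCast, Ring.choose_natCast]
    push_cast; ring
  rw [hP]
  have hs : (1 + 2 * s : ℚ) ≠ 0 := by positivity
  rcases Nat.lt_or_ge k s with hks | hks
  · rw [Nat.choose_eq_zero_of_lt (by omega : k + s + 1 < 2 * s + 1),
      Nat.choose_eq_zero_of_lt (by omega : k + s < 2 * s + 1),
      Nat.choose_eq_zero_of_lt (by omega : k + s < 2 * s)]
    simp
  · have h1 := Nat.add_one_mul_choose_eq (k + s) (2 * s)
    have h2 := Nat.choose_succ_right_eq (k + s) (2 * s)
    rw [show k + s - 2 * s = k - s by omega] at h2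
    have h1' : ((k : ℚ) + s + 1) * ((k + s).choose (2 * s)) =
        ((k + s + 1).choose (2 * s + 1)) * (2 * s + 1) := by exact_mod_cast h1
    have h2' : ((k + s).choose (2 * s + 1) : ℚ) * (2 * s + 1) =
        ((k + s).choose (2 * s)) * (k - s) := by
      rw [← Nat.cast_sub hks]; exact_mod_cast h2
    field_simp
    push_cast
    linear_combination -h1' + h2'

lemma lucas_pos (n : ℕ) : 0 < lucas n := by
  induction n using Nat.twoStepInduction with
  | zero => simp [lucas]
  | one => simp [lucas]
  | more n h1 h2 => simp only [lucas]; omega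

/-- The inverse of the odd Lucas number in the 5-adic integers. -/
noncomputable def W (k : ℕ) : ℤ_[5] := (-1) ^ k * H k

lemma W_mul (k : ℕ) : (lucas (2 * k + 1) : ℤ_[5]) * W k = 1 := by
  have := g_mul_H k
  unfold g at this
  rw [ext_nat, gl] at this
  push_cast at this
  unfold W
  linear_combination this

lemma clear (m e : ℕ) (c : ℕ → ℤ)
    (hc : (5 : ℤ_[5]) ^ e ∣ ∑ k ∈ Finset.range (m + 1), (c k : ℤ_[5]) * W k) :
    ∃ A : ℤ, (∏ j ∈ Finset.range (m + 1), (lucas (2 * j + 1) : ℚ)) *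
      ∑ k ∈ Finset.range (m + 1), (c k : ℚ) / lucas (2 * k + 1) = 5 ^ e * A := by
  set N : ℤ := ∑ k ∈ Finset.range (m + 1),
    c k * ∏ j ∈ (Finset.range (m + 1)).erase k, (lucas (2 * j + 1) : ℤ) with hN
  have h1 : (N : ℤ_[5]) = (∏ j ∈ Finset.range (m + 1), (lucas (2 * j + 1) : ℤ_[5])) *
      ∑ k ∈ Finset.range (m + 1), (c k : ℤ_[5]) * W k := by
    rw [hN, Finset.mul_sum]
    push_cast
    apply Finset.sum_congr rfl
    intro k hk
    rw [← Finset.mul_prod_erase _ _ hk]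
    linear_combination (-(c k : ℤ_[5]) *
      ∏ j ∈ (Finset.range (m + 1)).erase k, (lucas (2 * j + 1) : ℤ_[5])) * W_mul k
  have h2 : (5 : ℤ) ^ e ∣ N := by
    have := (PadicInt.pow_p_dvd_int_iff (p := 5) e N).1 (by
      rw [h1]; push_cast; exact hc.mul_left _)
    exact_mod_cast this
  obtain ⟨A, hA⟩ := h2
  refine ⟨A, ?_⟩
  have h3 : (N : ℚ) = 5 ^ e * A := by rw [hA]; push_cast; ring
  rw [← h3, hN, Finset.mul_sum]
  push_cast
  apply Finset.sum_congr rfl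
  intro k hk
  rw [← Finset.mul_prod_erase _ _ hk]
  have : (lucas (2 * k + 1) : ℚ) ≠ 0 := by exact_mod_cast (lucas_pos _).ne'
  field_simp

lemma const_int (m : ℕ) : ∃ B : ℤ, (∏ j ∈ Finset.range (m + 1), (lucas (2 * j + 1) : ℚ)) *
    (∑ k ∈ Finset.range (m + 1),
        (-1 : ℚ) ^ (m - k) * (Nat.choose (2 * m + 1) (m - k)) *
          ((Nat.fib (2 * k + 1) : ℚ) / (lucas (2 * k + 1))) * (5 : ℚ) ^ (-(m : ℤ))) = B := by
  obtain ⟨B, hB⟩ := clear m m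
    (fun k => (-1) ^ (m - k) * (Nat.choose (2 * m + 1) (m - k)) * Nat.fib (2 * k + 1)) (by
      convert const_dvd m using 2 with k hk
      unfold h W
      rw [ext_nat, hf]
      push_cast
      ring)
  refine ⟨B, ?_⟩
  rw [← Finset.sum_mul, ← mul_assoc]
  have h5 : (5 : ℚ) ^ (-(m : ℤ)) = (5 ^ m)⁻¹ := by rw [zpow_neg, zpow_natCast]
  rw [h5, mul_inv_eq_iff_eq_mul₀ (by positivity), mul_comm (B : ℚ), ← hB]
  congr 1
  apply Finset.sum_congr rfl
  intro k hk
  push_cast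
  ring

lemma coeff_int (m s : ℕ) (hs : s ≤ m) :
    ∃ A : ℤ, (∏ j ∈ Finset.range (m + 1), (lucas (2 * j + 1) : ℚ)) *
    (∑ k ∈ Finset.Icc s m,
          ((1 + 2 * k : ℚ) / (1 + 2 * s)) * (Nat.choose (2 * m + 1) (m - k)) *
            (Nat.choose (k + s) (2 * s)) * (-5 : ℚ) ^ ((s : ℤ) - (m : ℤ)) /
              (lucas (2 * k + 1))) = A := by
  obtain ⟨B, hB⟩ := clear m (m - s)
    (fun k => (Nat.choose (2 * m + 1) (m - k)) * P s k) (by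
      have hd := (coeff_dvd m s).mul_left ((-1) ^ m)
      convert hd using 1
      rw [Finset.mul_sum]
      apply Finset.sum_congr rfl
      intro k hk
      have hk' : k ≤ m := by simpa [Nat.lt_succ_iff] using hk
      have e : (-1 : ℤ_[5]) ^ m * (-1) ^ (m - k) = (-1) ^ k := by
        obtain ⟨d, rfl⟩ := Nat.exists_eq_add_of_le hk'
        rw [Nat.add_sub_cancel_left, pow_add, mul_assoc, ← mul_pow]
        simp
      unfold W
      push_cast
      linear_combination (-((2 * m + 1).choose (m - k) : ℤ_[5]) * (P s k : ℤ_[5]) * H k) * e)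
  refine ⟨(-1) ^ (m - s) * B, ?_⟩
  have h5 : (-5 : ℚ) ^ ((s : ℤ) - (m : ℤ)) = (-1) ^ (m - s) * (5 ^ (m - s))⁻¹ := by
    rw [show (s : ℤ) - (m : ℤ) = -((m - s : ℕ) : ℤ) by push_cast [hs]; ring, zpow_neg,
      zpow_natCast, show (-5 : ℚ) = (-1) * 5 by norm_num, mul_pow, mul_inv, ← inv_pow]
    norm_num
  have hsum : (∑ k ∈ Finset.Icc s m,
          ((1 + 2 * k : ℚ) / (1 + 2 * s)) * (Nat.choose (2 * m + 1) (m - k)) *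
            (Nat.choose (k + s) (2 * s)) * (-5 : ℚ) ^ ((s : ℤ) - (m : ℤ)) /
              (lucas (2 * k + 1))) =
      ((-1) ^ (m - s) * (5 ^ (m - s))⁻¹) * ∑ k ∈ Finset.range (m + 1),
        (((Nat.choose (2 * m + 1) (m - k)) * P s k : ℤ) : ℚ) / lucas (2 * k + 1) := by
    rw [Finset.mul_sum]
    have hsub : Finset.Icc s m ⊆ Finset.range (m + 1) := by
      intro k hk
      simp only [Finset.mem_Icc, Finset.mem_range] at hk ⊢
      omega
    rw [← Finset.sum_subset hsub]
    · apply Finset.sum_congr rfl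
      intro k hk
      rw [h5]
      push_cast
      rw [P_nat]
      ring
    · intro k hk hk2
      simp only [Finset.mem_Icc, Finset.mem_range] at hk hk2
      push_cast
      rw [P_nat, Nat.choose_eq_zero_of_lt (by omega : k + s < 2 * s)]
      simp
  rw [hsum, mul_left_comm, hB]
  push_cast
  field_simp

end OP

/-- For every positive integer `m`, the polynomial
`L 1 * L 3 * ⋯ * L (2m+1) * S_{2m+1}(x)` has only integer coefficients. -/
theorem integer_coefficients (m : ℕ) (hm : 0 < m) :
    ∃ T : Polynomial ℤ,
      C (∏ j ∈ Finset.range (m + 1), (lucas (2 * j + 1) : ℚ)) * ozekiProdinger m =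
        T.map (Int.castRingHom ℚ) := by
  obtain ⟨B, hB⟩ := OP.const_int m
  have hA : ∀ s, ∃ A : ℤ, s ≤ m → (∏ j ∈ Finset.range (m + 1), (lucas (2 * j + 1) : ℚ)) *
    (∑ k ∈ Finset.Icc s m,
          ((1 + 2 * k : ℚ) / (1 + 2 * s)) * (Nat.choose (2 * m + 1) (m - k)) *
            (Nat.choose (k + s) (2 * s)) * (-5 : ℚ) ^ ((s : ℤ) - (m : ℤ)) /
              (lucas (2 * k + 1))) = A := by
    intro s
    by_cases hs : s ≤ m
    · obtain ⟨A, hA⟩ := OP.coeff_int m s hs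
      exact ⟨A, fun _ => hA⟩
    · exact ⟨0, fun h => absurd h hs⟩
  choose A hA using hA
  refine ⟨∑ s ∈ Finset.range (m + 1), C (A s) * X ^ (2 * s + 1) - C B, ?_⟩
  unfold ozekiProdinger
  rw [mul_sub, ← C_mul, hB, Finset.mul_sum, Polynomial.map_sub, Polynomial.map_sum]
  congr 1
  · apply Finset.sum_congr rfl
    intro s hs
    rw [← mul_assoc, ← C_mul, hA s (by simpa [Nat.lt_succ_iff] using hs)]
    simp
  · simp
end

section
/- For all integers m, s with 0 ≤ s < m, the polynomial with rational coefficients P(X) = ∑_{k=s}^{m} ((1+2k)/(1+2s)) · C(2m+1, m-k) · C(k+s, 2s) · ∏_{j=s, j≠k}^{m} L_{2j+1}(X) is equal to (X^2+4)^{m-s} · Q(X) for some polynomial Q(X) with integer coefficients. (Equivalently: L_{2s+1}(x) L_{2s+3}(x) ⋯ L_{2m+1}(x) · ∑_{k=s}^{m} ((1+2k)/(1+2s)) C(2m+1, m-k) C(k+s, 2s) / L_{2k+1}(x) is an integer polynomial divisible by (x^2+4)^{m-s} in ℤ[x].) -/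
open Polynomial

/-- The Lucas polynomials: `L 0 = 2`, `L 1 = X`, `L (n+2) = X * L (n+1) + L n`. -/
noncomputable def lucasPoly : ℕ → Polynomial ℤ
  | 0 => 2
  | 1 => X
  | n + 2 => X * lucasPoly (n + 1) + lucasPoly n

lemma aux_fd (m : ℕ) (p : ℚ[X]) (hp : p.natDegree < m) :
    ∑ k ∈ Finset.range (m + 1), (-1 : ℚ) ^ k * (2 * k + 1) * (Nat.choose (2 * m + 1) (m - k)) *
      p.eval ((k : ℚ) * (k + 1)) = 0 := by
  set R : ℚ[X] := (2 * (C (m : ℚ) - X) + 1) * p.comp ((C (m : ℚ) - X) * (C (m : ℚ) - X + 1))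
    with hR
  have hdeg : R.natDegree < 2 * m + 1 := by
    have h1 : (2 * (C (m : ℚ) - X) + 1).natDegree ≤ 1 := by compute_degree
    have h2 : ((C (m : ℚ) - X) * (C (m : ℚ) - X + 1)).natDegree ≤ 2 := by compute_degree
    have h3 := natDegree_comp_le (p := p) (q := (C (m : ℚ) - X) * (C (m : ℚ) - X + 1))
    have h4 := Nat.mul_le_mul_left p.natDegree h2
    have h5 := natDegree_mul_le (p := (2 * (C (m : ℚ) - X) + 1))
      (q := p.comp ((C (m : ℚ) - X) * (C (m : ℚ) - X + 1)))
    rw [← hR] at h5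
    omega
  have h0 := congrFun (Polynomial.fwdDiff_iter_eq_zero_of_degree_lt hdeg) 0
  rw [fwdDiff_iter_eq_sum_shift] at h0
  set F : ℕ → ℚ := fun i => (-1 : ℚ) ^ i * (Nat.choose (2 * m + 1) i) * R.eval (i : ℚ) with hF
  have hsum : ∑ i ∈ Finset.range (2 * m + 1 + 1), F i = 0 := by
    have : ∑ i ∈ Finset.range (2 * m + 1 + 1), F i = - ∑ k ∈ Finset.range (2 * m + 1 + 1),
        ((-1 : ℤ) ^ (2 * m + 1 - k) * (2 * m + 1).choose k) • R.eval (0 + k • (1 : ℚ)) := by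
      rw [← Finset.sum_neg_distrib]
      refine Finset.sum_congr rfl fun i hi => ?_
      have hi' : i ≤ 2 * m + 1 := by simpa [Nat.lt_succ_iff] using hi
      obtain ⟨d, hd⟩ := Nat.exists_eq_add_of_le hi'
      have e1 : (-1 : ℚ) ^ i = - (-1) ^ d := by
        have e2 : (-1 : ℚ) ^ i * (-1) ^ d = -1 := by
          rw [← pow_add, ← hd, pow_succ, pow_mul]; norm_num
        have e3 : (-1 : ℚ) ^ d * (-1) ^ d = 1 := by
          rw [← mul_pow]; norm_num
        calc (-1 : ℚ) ^ i = (-1 : ℚ) ^ i * ((-1 : ℚ) ^ d * (-1) ^ d) := by rw [e3, mul_one]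
          _ = ((-1 : ℚ) ^ i * (-1) ^ d) * (-1) ^ d := by ring
          _ = _ := by rw [e2]; ring
      have e4 : 2 * m + 1 - i = d := by omega
      rw [e4]
      simp only [hF, e1, zsmul_eq_mul, zero_add, nsmul_eq_mul, mul_one]
      push_cast
      ring
    rw [this, h0]; simp
  rw [show 2 * m + 1 + 1 = (m + 1) + (m + 1) by ring, Finset.sum_range_add,
    ← Finset.sum_range_reflect] at hsum
  rw [← Finset.sum_add_distrib] at hsum
  have key : ∑ k ∈ Finset.range (m + 1), (-1 : ℚ) ^ k * (2 * k + 1) *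
      (Nat.choose (2 * m + 1) (m - k)) * p.eval ((k : ℚ) * (k + 1)) =
      (-1) ^ m / 2 * ∑ k ∈ Finset.range (m + 1), (F (m + 1 - 1 - k) + F (m + 1 + k)) := by
    rw [Finset.mul_sum]
    refine Finset.sum_congr rfl fun k hk => ?_
    have hk' : k ≤ m := by simpa [Nat.lt_succ_iff] using hk
    obtain ⟨d, rfl⟩ := Nat.exists_eq_add_of_le hk'
    have c1 : Nat.choose (2 * (k + d) + 1) (k + d + 1 + k) = Nat.choose (2 * (k + d) + 1) d := by
      rw [← Nat.choose_symm_of_eq_add]; omega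
    have e4 : k + d + 1 - 1 - k = d := by omega
    have e5 : k + d - k = d := by omega
    have hd2 : ((-1 : ℚ) ^ d) ^ 2 = 1 := by rw [← pow_mul, mul_comm, pow_mul]; norm_num
    have hk2 : ((-1 : ℚ) ^ k) ^ 2 = 1 := by rw [← pow_mul, mul_comm, pow_mul]; norm_num
    rw [e4, e5]
    simp only [hF, hR, c1, eval_mul, eval_add, eval_sub, eval_C, eval_X, eval_comp, eval_one,
      eval_ofNat]
    push_cast
    have a1 : ((k : ℚ) + d - d) * (k + d - d + 1) = k * (k + 1) := by ring
    have a2 : ((k : ℚ) + d - (k + d + 1 + k)) * (k + d - (k + d + 1 + k) + 1) = k * (k + 1) := by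
      ring
    rw [a1, a2]
    simp only [pow_add, pow_one]
    generalize eval ((k : ℚ) * (k + 1)) p = P
    generalize (-1 : ℚ) ^ d = D at *
    generalize (-1 : ℚ) ^ k = K at *
    linear_combination (-(2 * (k:ℚ) + 1) * ((2 * (k + d) + 1).choose d) * P * K) * (1 / 2 + K ^ 2 / 2) * hd2
      - (2 * (k:ℚ) + 1) * ((2 * (k + d) + 1).choose d) * P * K * (1 / 2) * hk2
  rw [key, hsum, mul_zero]

lemma aux_choose_poly (r : ℕ) : ∃ q : ℚ[X], q.natDegree ≤ r ∧
    ∀ k : ℕ, (Nat.choose (k + r) (2 * r) : ℚ) = q.eval ((k : ℚ) * (k + 1)) := by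
  induction r with
  | zero => exact ⟨1, by simp, by simp⟩
  | succ r ih =>
    obtain ⟨q, hq, hk⟩ := ih
    refine ⟨q * (X - C ((r : ℚ) * (r + 1))) * C (1 / ((2 * r + 1) * (2 * r + 2) : ℚ)), ?_, ?_⟩
    · refine (natDegree_mul_C_le _ _).trans (natDegree_mul_le.trans ?_)
      rw [natDegree_X_sub_C]
      omega
    · intro k
      have h1 : ((k + r + 1 : ℕ) : ℚ) * (k + r).choose (2 * r + 1) =
          (k + r + 1).choose (2 * r + 1 + 1) * ((2 * r + 1 + 1 : ℕ) : ℚ) := by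
        exact_mod_cast Nat.add_one_mul_choose_eq (k + r) (2 * r + 1)
      have h2 : ((k + r).choose (2 * r + 1) : ℚ) * (2 * r + 1) =
          (k + r).choose (2 * r) * ((k : ℚ) - r) := by
        rcases lt_or_ge k r with h | h
        · rw [Nat.choose_eq_zero_of_lt (by omega : k + r < 2 * r),
            Nat.choose_eq_zero_of_lt (by omega : k + r < 2 * r + 1)]; simp
        · have := Nat.choose_succ_right_eq (k + r) (2 * r)
          obtain ⟨d, rfl⟩ := Nat.exists_eq_add_of_le h
          rw [show r + d + r - 2 * r = d by omega] at this
          have h3 : ((r + d + r).choose (2 * r + 1) : ℚ) * (2 * r + 1) =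
            (r + d + r).choose (2 * r) * d := by exact_mod_cast this
          rw [h3]; push_cast; ring
      rw [eval_mul, eval_mul, ← hk k]
      simp only [eval_sub, eval_X, eval_C]
      have p1 : (2 * (r : ℚ) + 1) ≠ 0 := by positivity
      have p2 : (2 * (r : ℚ) + 2) ≠ 0 := by positivity
      rw [show k + (r + 1) = k + r + 1 by ring, show 2 * (r + 1) = 2 * r + 1 + 1 by ring]
      push_cast at h1
      field_simp
      linear_combination (-(2 * (r : ℚ) + 1)) * h1 + (k + r + 1) * h2

/-- `gPoly k (X^2+4)` is `(-1)^k L_{2k+1} / X`. -/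
noncomputable def gPoly : ℕ → ℚ[X]
  | 0 => 1
  | 1 => 1 - X
  | n + 2 => (2 - X) * gPoly (n + 1) - gPoly n

lemma gPoly_coeff (k r : ℕ) : (gPoly k).coeff r = (-1) ^ r * (Nat.choose (k + r) (2 * r) : ℚ) := by
  induction k using Nat.twoStepInduction generalizing r with
  | zero =>
    rcases r with _ | r
    · simp [gPoly]
    · rw [Nat.choose_eq_zero_of_lt (by omega)]; simp [gPoly, coeff_one]
  | one =>
    rcases r with _ | _ | r
    · simp [gPoly]
    · simp [gPoly, coeff_one]
    · rw [Nat.choose_eq_zero_of_lt (by omega)]; simp [gPoly, coeff_one, coeff_X]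
  | more n h1 h2 =>
    rw [gPoly, sub_mul, coeff_sub, coeff_sub, ← C_ofNat, coeff_C_mul]
    rcases r with _ | r
    · rw [h1, h2]; simp; norm_num
    · rw [coeff_X_mul, h1, h2, h2]
      have e1 : n + 2 + (r + 1) = n + r + 1 + 1 + 1 := by ring
      have e2 : n + 1 + (r + 1) = n + r + 1 + 1 := by ring
      have e3 : n + 1 + r = n + r + 1 := by ring
      have e4 : n + (r + 1) = n + r + 1 := by ring
      have e5 : 2 * (r + 1) = 2 * r + 1 + 1 := by ring
      rw [e1, e2, e3, e4, e5, Nat.choose_succ_succ (n + r + 1 + 1) (2 * r + 1),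
        Nat.choose_succ_succ (n + r + 1) (2 * r), Nat.choose_succ_succ (n + r + 1) (2 * r + 1)]
      push_cast
      ring

lemma lucas_step (n : ℕ) : lucasPoly (n + 4) = (X ^ 2 + 2) * lucasPoly (n + 2) - lucasPoly n := by
  have h1 : lucasPoly (n + 4) = X * lucasPoly (n + 3) + lucasPoly (n + 2) := by rw [lucasPoly]
  have h2 : lucasPoly (n + 3) = X * lucasPoly (n + 2) + lucasPoly (n + 1) := by rw [lucasPoly]
  have h3 : lucasPoly (n + 2) = X * lucasPoly (n + 1) + lucasPoly n := by rw [lucasPoly]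
  rw [h1, h2]
  linear_combination (-1 : ℤ[X]) * h3

lemma lucas_eq (k : ℕ) : (lucasPoly (2 * k + 1)).map (Int.castRingHom ℚ) =
    X * ((-1) ^ k * (gPoly k).comp (X ^ 2 + C 4)) := by
  induction k using Nat.twoStepInduction with
  | zero => simp [lucasPoly, gPoly]
  | one =>
    simp [lucasPoly, gPoly]
    rw [show (C 4 : ℚ[X]) = 4 from rfl]
    ring
  | more n h1 h2 =>
    rw [show 2 * (n + 2) + 1 = (2 * n + 1) + 4 by ring, lucas_step,
      show 2 * n + 1 + 2 = 2 * (n + 1) + 1 by ring, gPoly]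
    simp only [Polynomial.map_sub, Polynomial.map_mul, h1, h2]
    simp
    rw [show (C 4 : ℚ[X]) = 4 from rfl]
    ring

lemma aux_inv (n : ℕ) : ∃ q : ℚ[X], q.natDegree ≤ n ∧
    ∀ k : ℕ, PowerSeries.coeff n ((gPoly k : PowerSeries ℚ)⁻¹) = q.eval ((k : ℚ) * (k + 1)) := by
  induction n using Nat.strong_induction_on with
  | _ n ih =>
    have hc : ∀ k, PowerSeries.constantCoeff (gPoly k : PowerSeries ℚ) = 1 := by
      intro k
      have := gPoly_coeff k 0
      simp at this
      simpa using this
    rcases Nat.eq_zero_or_pos n with rfl | hn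
    · refine ⟨1, by simp, fun k => ?_⟩
      rw [PowerSeries.coeff_inv, hc]; simp
    · choose! h hd hk using ih
      choose b bd bk using aux_choose_poly
      refine ⟨-∑ x ∈ Finset.HasAntidiagonal.antidiagonal n,
        if x.2 < n then C ((-1 : ℚ) ^ x.1) * b x.1 * h x.2 else 0, ?_, fun k => ?_⟩
      · rw [natDegree_neg]
        refine natDegree_sum_le_of_forall_le _ _ fun x hx => ?_
        split_ifs with hlt
        · refine natDegree_mul_le.trans ?_
          have h1 := (natDegree_C_mul_le ((-1 : ℚ) ^ x.1) (b x.1)).trans (bd x.1)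
          have h2 := hd x.2 hlt
          have h3 := Finset.HasAntidiagonal.mem_antidiagonal.1 hx
          omega
        · simp
      · rw [PowerSeries.coeff_inv, hc, if_neg hn.ne', eval_neg, eval_finsetSum]
        simp only [inv_one, neg_mul, one_mul]
        congr 1
        refine Finset.sum_congr rfl fun x hx => ?_
        split_ifs with hlt
        · rw [hk _ hlt, Polynomial.coeff_coe, gPoly_coeff, bk]
          simp
        · simp

/-- The coefficients. -/
def aCoef (m s k : ℕ) : ℚ :=
  ((1 + 2 * k : ℚ) / (1 + 2 * s)) * (Nat.choose (2 * m + 1) (m - k)) * (Nat.choose (k + s) (2 * s))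

lemma aCoef_int (m s k : ℕ) : ∃ z : ℤ, aCoef m s k = z := by
  refine ⟨(Nat.choose (2 * m + 1) (m - k)) *
    ((k + s + 1).choose (2 * s + 1) + (k + s).choose (2 * s + 1)), ?_⟩
  have h1 : ((k + s + 1 : ℕ) : ℚ) * (k + s).choose (2 * s) =
      (k + s + 1).choose (2 * s + 1) * ((2 * s + 1 : ℕ) : ℚ) := by
    exact_mod_cast Nat.add_one_mul_choose_eq (k + s) (2 * s)
  have h2 : ((k + s + 1).choose (2 * s + 1) : ℚ) =
      (k + s).choose (2 * s) + (k + s).choose (2 * s + 1) := by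
    exact_mod_cast Nat.choose_succ_succ (k + s) (2 * s)
  have p1 : (1 + 2 * (s : ℚ)) ≠ 0 := by positivity
  rw [aCoef]
  push_cast at h1 ⊢
  field_simp
  linear_combination ((2 * m + 1).choose (m - k) : ℚ) * (2 * h1 + (1 + 2 * s) * h2)

lemma aCoef_orth (m s : ℕ) (hsm : s < m) (p : ℚ[X]) (hp : p.natDegree < m - s) :
    ∑ k ∈ Finset.Icc s m, aCoef m s k * (-1) ^ k * p.eval ((k : ℚ) * (k + 1)) = 0 := by
  obtain ⟨q, hq, hk⟩ := aux_choose_poly s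
  have h := aux_fd m (q * p) (natDegree_mul_le.trans_lt (by omega))
  have hsub : ∑ k ∈ Finset.Icc s m, aCoef m s k * (-1) ^ k * p.eval ((k : ℚ) * (k + 1)) =
      ∑ k ∈ Finset.range (m + 1), aCoef m s k * (-1) ^ k * p.eval ((k : ℚ) * (k + 1)) := by
    refine Finset.sum_subset ?_ ?_
    · intro k hk; simp at hk ⊢; omega
    · intro k hk hk'
      simp at hk hk'
      rw [aCoef, Nat.choose_eq_zero_of_lt (by omega : k + s < 2 * s)]; simp
  rw [hsub]
  have : ∀ k ∈ Finset.range (m + 1), aCoef m s k * (-1) ^ k * p.eval ((k : ℚ) * (k + 1)) =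
      1 / (1 + 2 * s) * ((-1 : ℚ) ^ k * (2 * k + 1) * (Nat.choose (2 * m + 1) (m - k)) *
      (q * p).eval ((k : ℚ) * (k + 1))) := by
    intro k _
    rw [eval_mul, ← hk, aCoef]; ring
  rw [Finset.sum_congr rfl this, ← Finset.mul_sum, h, mul_zero]

lemma S_dvd (m s : ℕ) (hsm : s < m) :
    (X : ℚ[X]) ^ (m - s) ∣ ∑ k ∈ Finset.Icc s m, C (aCoef m s k * (-1) ^ k) *
      ∏ j ∈ (Finset.Icc s m).erase k, gPoly j := by
  have hc : ∀ k, PowerSeries.constantCoeff (gPoly k : PowerSeries ℚ) ≠ 0 := by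
    intro k
    have := gPoly_coeff k 0
    simp at this
    simp [this]
  have hps : ((∑ k ∈ Finset.Icc s m, C (aCoef m s k * (-1) ^ k) *
      ∏ j ∈ (Finset.Icc s m).erase k, gPoly j : ℚ[X]) : PowerSeries ℚ) =
      ((∏ j ∈ Finset.Icc s m, gPoly j : ℚ[X]) : PowerSeries ℚ) *
      ∑ k ∈ Finset.Icc s m, PowerSeries.C (aCoef m s k * (-1) ^ k) *
        (gPoly k : PowerSeries ℚ)⁻¹ := by
    rw [Finset.mul_sum, ← Polynomial.coeToPowerSeries.ringHom_apply, map_sum]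
    refine Finset.sum_congr rfl fun k hk => ?_
    rw [Polynomial.coeToPowerSeries.ringHom_apply, ← Finset.mul_prod_erase _ _ hk]
    push_cast
    have := PowerSeries.mul_inv_cancel _ (hc k)
    linear_combination (-(PowerSeries.C (aCoef m s k * (-1) ^ k) *
      ((∏ j ∈ (Finset.Icc s m).erase k, gPoly j : ℚ[X]) : PowerSeries ℚ))) * this
  have hd : (PowerSeries.X : PowerSeries ℚ) ^ (m - s) ∣
      ∑ k ∈ Finset.Icc s m, PowerSeries.C (aCoef m s k * (-1) ^ k) *
        (gPoly k : PowerSeries ℚ)⁻¹ := by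
    rw [PowerSeries.X_pow_dvd_iff]
    intro n hn
    obtain ⟨q, hq, hk⟩ := aux_inv n
    rw [map_sum]
    simp only [PowerSeries.coeff_C_mul, hk]
    exact aCoef_orth m s hsm q (by omega)
  have hd2 := hd.mul_left ((∏ j ∈ Finset.Icc s m, gPoly j : ℚ[X]) : PowerSeries ℚ)
  rw [← hps, PowerSeries.X_pow_dvd_iff] at hd2
  rw [Polynomial.X_pow_dvd_iff]
  intro d hdm
  rw [← Polynomial.coeff_coe]
  exact hd2 d hdm

lemma P_dvd (m s : ℕ) (hsm : s < m) :
    ((X : ℚ[X]) ^ 2 + C 4) ^ (m - s) ∣ ∑ k ∈ Finset.Icc s m, C (aCoef m s k) *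
      ∏ j ∈ (Finset.Icc s m).erase k, (lucasPoly (2 * j + 1)).map (Int.castRingHom ℚ) := by
  obtain ⟨T, hT⟩ := S_dvd m s hsm
  have hT2 := congrArg (fun p : ℚ[X] => p.comp (X ^ 2 + C 4)) hT
  simp only [Polynomial.sum_comp, mul_comp, C_comp, Polynomial.prod_comp, pow_comp, X_comp] at hT2
  refine ⟨X ^ (m - s) * (∏ j ∈ Finset.Icc s m, (-1 : ℚ[X]) ^ j) * T.comp (X ^ 2 + C 4), ?_⟩
  have : ((X : ℚ[X]) ^ 2 + C 4) ^ (m - s) * (X ^ (m - s) * (∏ j ∈ Finset.Icc s m, (-1 : ℚ[X]) ^ j) *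
      T.comp (X ^ 2 + C 4)) = (X ^ (m - s) * (∏ j ∈ Finset.Icc s m, (-1 : ℚ[X]) ^ j)) *
      (((X : ℚ[X]) ^ 2 + C 4) ^ (m - s) * T.comp (X ^ 2 + C 4)) := by ring
  rw [this, ← hT2, Finset.mul_sum]
  refine Finset.sum_congr rfl fun k hk => ?_
  have hcard : ((Finset.Icc s m).erase k).card = m - s := by
    rw [Finset.card_erase_of_mem hk, Nat.card_Icc]; omega
  simp only [lucas_eq]
  rw [Finset.prod_mul_distrib, Finset.prod_const, hcard, Finset.prod_mul_distrib,
    ← Finset.mul_prod_erase (Finset.Icc s m) (fun j => (-1 : ℚ[X]) ^ j) hk]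
  have hk2 : ((-1 : ℚ[X]) ^ k) * (-1) ^ k = 1 := by rw [← mul_pow]; norm_num
  have hC : (C (aCoef m s k * (-1) ^ k) : ℚ[X]) = C (aCoef m s k) * (-1) ^ k := by simp
  rw [hC]
  generalize (∏ j ∈ (Finset.Icc s m).erase k, (-1 : ℚ[X]) ^ j) = A
  generalize (∏ j ∈ (Finset.Icc s m).erase k, (gPoly j).comp (X ^ 2 + C 4)) = B
  linear_combination (-(C (aCoef m s k) * X ^ (m - s) * A * B)) * hk2

theorem x_sq_add_four_divisibility (m s : ℕ) (hsm : s < m) :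
    ∃ Q : Polynomial ℤ,
      (∑ k ∈ Finset.Icc s m,
          C (((1 + 2 * k : ℚ) / (1 + 2 * s)) * (Nat.choose (2 * m + 1) (m - k)) *
              (Nat.choose (k + s) (2 * s))) *
            ∏ j ∈ (Finset.Icc s m).erase k, (lucasPoly (2 * j + 1)).map (Int.castRingHom ℚ)) =
        (X ^ 2 + C 4) ^ (m - s) * Q.map (Int.castRingHom ℚ) := by
  have h := P_dvd m s hsm
  choose z hz using aCoef_int m s
  have e1 : ∑ k ∈ Finset.Icc s m, C (aCoef m s k) *
      ∏ j ∈ (Finset.Icc s m).erase k, (lucasPoly (2 * j + 1)).map (Int.castRingHom ℚ) =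
      (∑ k ∈ Finset.Icc s m, C (z k) *
      ∏ j ∈ (Finset.Icc s m).erase k, (lucasPoly (2 * j + 1))).map (Int.castRingHom ℚ) := by
    simp [Polynomial.map_sum, Polynomial.map_prod, hz]
  have e2 : ((X : ℚ[X]) ^ 2 + C 4) ^ (m - s) =
      (((X : ℤ[X]) ^ 2 + C 4) ^ (m - s)).map (Int.castRingHom ℚ) := by
    simp
    rfl
  have hm : (((X : ℤ[X]) ^ 2 + C 4) ^ (m - s)).Monic :=
    (monic_X_pow_add_C (4 : ℤ) two_ne_zero).pow _
  rw [e1, e2, Polynomial.map_dvd_map _ Int.cast_injective hm] at h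
  obtain ⟨Q, hQ⟩ := h
  refine ⟨Q, ?_⟩
  change ∑ k ∈ Finset.Icc s m, C (aCoef m s k) *
      ∏ j ∈ (Finset.Icc s m).erase k, (lucasPoly (2 * j + 1)).map (Int.castRingHom ℚ) = _
  rw [e1, hQ, Polynomial.map_mul, ← e2]
end

section
/- For all integers m, s with 0 ≤ s ≤ m, there exists an integer z such that the rational number (∏_{j=s}^{m} L_{2j+1}) · ∑_{k=s}^{m} ((1+2k)/(1+2s)) · C(2m+1, m-k) · C(k+s, 2s) / L_{2k+1} equals 5^{m-s} · z. In other words, 5^{m-s} divides the integer L_{2s+1} L_{2s+3} ⋯ L_{2m+1} · ∑_{k=s}^{m} ((1+2k)/(1+2s)) C(2m+1, m-k) C(k+s, 2s) / L_{2k+1}. -/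
open Polynomial in
/-- Auxiliary integer polynomials. -/
noncomputable def auxH : ℕ → Polynomial ℤ
  | 0 => 1
  | 1 => 4 * X + 3
  | n + 2 => (3 * X + 2) * auxH (n + 1) - (X + 1) ^ 2 * auxH n

/-- `(2k+1)/(2s+1) * C(k+s,2s)` as a natural number. -/
def auxA (k s : ℕ) : ℕ := Nat.choose (k + s + 1) (2 * s + 1) + Nat.choose (k + s) (2 * s + 1)

lemma auxA_eq (k s : ℕ) (h : s ≤ k) :
    (auxA k s : ℝ) = (1 + 2 * k : ℝ) / (1 + 2 * s) * Nat.choose (k + s) (2 * s) := by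
  have h1 := Nat.add_one_mul_choose_eq (k + s) (2 * s)
  have h2 := Nat.choose_succ_right_eq (k + s) (2 * s)
  have h3 : k + s - 2 * s = k - s := by omega
  rw [h3] at h2
  have h1' : ((k + s + 1 : ℝ)) * Nat.choose (k + s) (2 * s)
      = Nat.choose (k + s + 1) (2 * s + 1) * (2 * s + 1) := by exact_mod_cast h1
  have h2' : (Nat.choose (k + s) (2 * s + 1) : ℝ) * (2 * s + 1)
      = Nat.choose (k + s) (2 * s) * (k - s) := by
    rw [← Nat.cast_sub h]; exact_mod_cast h2
  have h4 : (1 + 2 * s : ℝ) ≠ 0 := by positivity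
  unfold auxA
  push_cast
  field_simp
  linarith

lemma auxA_zero (k s : ℕ) (h : k < s) : auxA k s = 0 := by
  unfold auxA
  rw [Nat.choose_eq_zero_of_lt (by omega), Nat.choose_eq_zero_of_lt (by omega)]

lemma auxA_k0 (k : ℕ) : auxA k 0 = 2 * k + 1 := by
  simp [auxA]; omega

lemma choose_rec (k s : ℕ) :
    Nat.choose (k + s + 3) (2 * s + 3) + Nat.choose (k + s + 1) (2 * s + 3)
      = 2 * Nat.choose (k + s + 2) (2 * s + 3) + Nat.choose (k + s + 1) (2 * s + 1) := by
  have e1 := Nat.choose_succ_succ (k + s + 2) (2 * s + 2)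
  have e2 := Nat.choose_succ_succ (k + s + 1) (2 * s + 2)
  have e3 := Nat.choose_succ_succ (k + s + 1) (2 * s + 1)
  simp only [Nat.succ_eq_add_one, Nat.add_assoc, Nat.reduceAdd] at *
  omega

lemma auxA_rec (k s : ℕ) :
    auxA (k + 2) (s + 1) + auxA k (s + 1) = 2 * auxA (k + 1) (s + 1) + auxA (k + 1) s := by
  have h1 := choose_rec k s
  have h2 := choose_rec (k + 1) s
  unfold auxA
  have e1 : 2 * (s + 1) + 1 = 2 * s + 3 := by ring
  have e2 : k + 2 + (s + 1) = k + s + 3 := by ring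
  have e3 : k + (s + 1) = k + s + 1 := by ring
  have e4 : k + 1 + (s + 1) = k + s + 2 := by ring
  have e5 : k + 1 + s = k + s + 1 := by ring
  rw [e1, e2, e3, e4, e5]
  rw [show k + 1 + s + 3 = k + s + 3 + 1 by ring, show k + 1 + s + 1 = k + s + 1 + 1 by ring,
    show k + 1 + s + 2 = k + s + 2 + 1 by ring] at h2
  omega

lemma auxB_rec (k N : ℕ) (hk : k + 1 < N) (y : ℝ) :
    ∑ s ∈ Finset.range (N + 1), (-1 : ℝ) ^ (k + s) * auxA (k + 2) s * y ^ s
      = (y - 2) * ∑ s ∈ Finset.range (N + 1), (-1 : ℝ) ^ (k + 1 + s) * auxA (k + 1) s * y ^ s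
        - ∑ s ∈ Finset.range (N + 1), (-1 : ℝ) ^ (k + s) * auxA k s * y ^ s := by
  have h : ∑ s ∈ Finset.range (N + 1), (-1 : ℝ) ^ (k + 1 + s) * auxA (k + 1) s * y ^ s
      = ∑ s ∈ Finset.range N, (-1 : ℝ) ^ (k + 1 + s) * auxA (k + 1) s * y ^ s := by
    rw [Finset.sum_range_succ, auxA_zero (k + 1) N hk]; simp
  rw [sub_mul]
  nth_rewrite 1 [h]
  rw [Finset.sum_range_succ', Finset.sum_range_succ', Finset.sum_range_succ']
  simp only [auxA_k0]
  have key : ∀ s, (-1 : ℝ) ^ (k + (s + 1)) * auxA (k + 2) (s + 1) * y ^ (s + 1)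
      = y * ((-1 : ℝ) ^ (k + 1 + s) * auxA (k + 1) s * y ^ s)
        - 2 * ((-1 : ℝ) ^ (k + 1 + (s + 1)) * auxA (k + 1) (s + 1) * y ^ (s + 1))
        - (-1 : ℝ) ^ (k + (s + 1)) * auxA k (s + 1) * y ^ (s + 1) := by
    intro s
    have := auxA_rec k s
    have h' : (auxA (k + 2) (s + 1) : ℝ) = 2 * auxA (k + 1) (s + 1) + auxA (k + 1) s
        - auxA k (s + 1) := by
      rw [eq_sub_iff_add_eq]; exact_mod_cast this
    rw [h']; ring
  rw [Finset.sum_congr rfl (fun s _ => key s), Finset.sum_sub_distrib, Finset.sum_sub_distrib,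
    ← Finset.mul_sum, ← Finset.mul_sum]
  push_cast
  ring

lemma auxB_eq (x x' : ℝ) (hx : x * x' = 1) (N k : ℕ) (hk : k < N) :
    (x + x') * ∑ s ∈ Finset.range (N + 1), (-1 : ℝ) ^ (k + s) * auxA k s * ((x + x') ^ 2) ^ s
      = x ^ (2 * k + 1) + x' ^ (2 * k + 1) := by
  induction k using Nat.twoStepInduction with
  | zero =>
    rw [Finset.sum_range_succ', Finset.sum_eq_zero]
    · simp [auxA]
    · intro s _
      rw [auxA_zero 0 (s + 1) (by omega)]; simp
  | one =>
    obtain ⟨N, rfl⟩ : ∃ M, N = M + 1 := ⟨N - 1, by omega⟩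
    rw [Finset.sum_range_succ', Finset.sum_range_succ', Finset.sum_eq_zero]
    · simp [auxA, Nat.choose]
      linear_combination 3 * (x + x') * hx
    · intro s _
      rw [auxA_zero 1 (s + 1 + 1) (by omega)]; simp
  | more k ih1 ih2 =>
    have i1 := ih1 (by omega)
    have i2 := ih2 (by omega)
    have e : ∀ s, (-1 : ℝ) ^ (k + 2 + s) = (-1) ^ (k + s) := by intro s; ring
    simp only [e]
    rw [auxB_rec k N (by omega), mul_sub, mul_left_comm, i1, i2]
    simp only [show 2 * (k + 2) + 1 = 2 * k + 5 by ring, show 2 * (k + 1) + 1 = 2 * k + 3 by ring]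
    have e1 : x ^ (2 * k + 3) * x' ^ 2 = x ^ (2 * k + 1) := by
      rw [show x ^ (2 * k + 3) * x' ^ 2 = x ^ (2 * k + 1) * (x * x') ^ 2 by ring, hx]; ring
    have e2 : x' ^ (2 * k + 3) * x ^ 2 = x' ^ (2 * k + 1) := by
      rw [show x' ^ (2 * k + 3) * x ^ 2 = x' ^ (2 * k + 1) * (x * x') ^ 2 by ring, hx]; ring
    linear_combination e1 + e2 + 2 * (x ^ (2 * k + 3) + x' ^ (2 * k + 3)) * hx

lemma auxPow (x x' : ℝ) (hx : x * x' = 1) (m : ℕ) :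
    ∑ k ∈ Finset.range (m + 1), (-1 : ℝ) ^ (m + k) * Nat.choose (2 * m + 1) (m - k) *
      (x ^ (2 * k + 1) - x' ^ (2 * k + 1)) = (x - x') ^ (2 * m + 1) := by
  rw [sub_eq_add_neg x x', add_pow, show 2 * m + 1 + 1 = (m + 1) + (m + 1) by ring,
    Finset.sum_range_add _ (m + 1) (m + 1),
    ← Finset.sum_range_reflect (fun i => x ^ i * (-x') ^ (2 * m + 1 - i) *
      (Nat.choose (2 * m + 1) i : ℝ)) (m + 1), ← Finset.sum_add_distrib]
  apply Finset.sum_congr rfl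
  intro k hk
  have hk' : k ≤ m := by simpa [Nat.lt_succ_iff] using hk
  obtain ⟨d, rfl⟩ := Nat.exists_eq_add_of_le hk'
  have c : Nat.choose (2 * (k + d) + 1) (k + d + 1 + k) = Nat.choose (2 * (k + d) + 1) d := by
    apply Nat.choose_symm_of_eq_add; omega
  rw [show k + d + 1 - 1 - k = d by omega, show k + d - k = d by omega, c,
    show 2 * (k + d) + 1 - d = 2 * k + 1 + d by omega,
    show 2 * (k + d) + 1 - (k + d + 1 + k) = d by omega]
  have s1 : (-x') ^ (2 * k + 1 + d) = - ((-1) ^ d * (x' ^ (2 * k + 1) * x' ^ d)) := by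
    rw [neg_pow, show (-1 : ℝ) ^ (2 * k + 1 + d) = - (-1) ^ d by
      rw [pow_add, pow_succ, pow_mul]; simp]
    ring
  have s2 : (-x') ^ d = (-1) ^ d * x' ^ d := by rw [neg_pow]
  have s3 : (-1 : ℝ) ^ (k + d + k) = (-1) ^ d := by
    rw [show k + d + k = 2 * k + d by ring, pow_add, pow_mul]; simp
  have s4 : x ^ d * x' ^ d = 1 := by rw [← mul_pow, hx, one_pow]
  rw [s1, s2, s3, show k + d + 1 + k = 2 * k + 1 + d by ring, pow_add x]
  linear_combination (-(-1) ^ d * ((2 * (k + d) + 1).choose d : ℝ) *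
    (x ^ (2 * k + 1) - x' ^ (2 * k + 1))) * s4

lemma lucas_pos (n : ℕ) : 0 < lucas n := by
  induction n using Nat.twoStepInduction with
  | zero => simp [lucas]
  | one => simp [lucas]
  | more n h1 h2 => simp [lucas]; omega

lemma lucas_add4 (n : ℕ) : (lucas (n + 4) : ℤ) = 3 * lucas (n + 2) - lucas n := by
  simp only [lucas]; push_cast; ring

lemma lucas_eq_s3 (a b : ℝ) (hab : a * b = 1) (h : a - b = 1) (k : ℕ) :
    (lucas (2 * k + 1) : ℝ) = a ^ (2 * k + 1) - b ^ (2 * k + 1) := by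
  induction k using Nat.twoStepInduction with
  | zero => simp [lucas, h]
  | one =>
    simp [lucas]
    obtain rfl : a = b + 1 := by linarith
    linear_combination -3 * hab
  | more k h1 h2 =>
    have := lucas_add4 (2 * k + 1)
    have t : (lucas (2 * k + 1 + 4) : ℝ) = 3 * lucas (2 * k + 1 + 2) - lucas (2 * k + 1) := by
      exact_mod_cast this
    rw [show 2 * (k + 2) + 1 = 2 * k + 1 + 4 by ring, t, h1,
      show 2 * k + 1 + 2 = 2 * (k + 1) + 1 by ring, h2]
    obtain rfl : a = b + 1 := by linarith
    have q : b ^ 2 = 1 - b := by linarith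
    have q1 : b ^ 4 = 2 - 3 * b := by rw [show b ^ 4 = (b ^ 2) ^ 2 by ring, q]; linarith
    have p : (b + 1) ^ 2 = b + 2 := by linarith
    have p1 : (b + 1) ^ 4 = 5 + 3 * b := by
      rw [show (b + 1) ^ 4 = ((b + 1) ^ 2) ^ 2 by ring, p]; linarith
    rw [show (b + 1) ^ (2 * (k + 1) + 1) = (b + 1) ^ (2 * k + 1) * (b + 1) ^ 2 by ring,
      show b ^ (2 * (k + 1) + 1) = b ^ (2 * k + 1) * b ^ 2 by ring, pow_add _ (2 * k + 1) 4,
      pow_add b (2 * k + 1) 4, p1, q1, p, q]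
    ring

open Polynomial in
lemma auxH_eval (u v z w : ℝ) (h : u - v = z) (huv : u * v = z ^ 2 + 5) (hw : z ^ 2 = 5 * w)
    (s : ℕ) :
    z * 5 ^ s * ((auxH s).map (Int.castRingHom ℝ)).eval w = u ^ (2 * s + 1) - v ^ (2 * s + 1) := by
  induction s using Nat.twoStepInduction with
  | zero => simp [auxH, h]
  | one =>
    simp [auxH]
    subst h
    linear_combination (-4 * (u - v)) * hw - 3 * (u - v) * huv
  | more s h1 h2 =>
    simp only [auxH, Polynomial.map_sub, Polynomial.map_mul, Polynomial.map_add,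
      Polynomial.map_pow, Polynomial.eval_sub, Polynomial.eval_mul, Polynomial.eval_add,
      Polynomial.eval_pow, Polynomial.map_X, Polynomial.eval_X, Polynomial.map_ofNat,
      Polynomial.eval_ofNat, Polynomial.map_one, Polynomial.eval_one]
    have e1 : u ^ 2 + v ^ 2 = 5 * (3 * w + 2) := by
      subst h; linear_combination 3 * hw + 2 * huv
    have e2 : u ^ 2 * v ^ 2 = 25 * (w + 1) ^ 2 := by
      rw [← mul_pow, huv, hw]; ring
    have : u ^ (2 * (s + 2) + 1) - v ^ (2 * (s + 2) + 1)
      = (u ^ 2 + v ^ 2) * (u ^ (2 * (s + 1) + 1) - v ^ (2 * (s + 1) + 1))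
        - (u ^ 2 * v ^ 2) * (u ^ (2 * s + 1) - v ^ (2 * s + 1)) := by ring
    rw [this, e1, e2, ← h1, ← h2]
    ring

open Polynomial in
lemma auxH_deg (s : ℕ) : (auxH s).natDegree ≤ s ∧ (auxH s).coeff s = lucas (2 * s + 1) := by
  induction s using Nat.twoStepInduction with
  | zero => simp [auxH, lucas]
  | one =>
    constructor
    · simp only [auxH]; compute_degree
    · simp only [auxH, lucas]; compute_degree; norm_num
  | more s h1 h2 =>
    obtain ⟨d1, c1⟩ := h1
    obtain ⟨d2, c2⟩ := h2
    have n1 : ((3 * X + 2 : ℤ[X])).natDegree ≤ 1 := by compute_degree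
    have n2 : ((X + 1 : ℤ[X]) ^ 2).natDegree ≤ 2 := by compute_degree
    have k1 : ((3 * X + 2 : ℤ[X])).coeff 1 = 3 := by compute_degree
    have k2 : ((X + 1 : ℤ[X]) ^ 2).coeff 2 = 1 := by
      compute_degree
    constructor
    · simp only [auxH]
      apply (natDegree_sub_le _ _).trans
      apply max_le
      · exact natDegree_mul_le.trans (by omega)
      · exact natDegree_mul_le.trans (by omega)
    · simp only [auxH, coeff_sub]
      have m1 := coeff_mul_add_eq_of_natDegree_le n1 d2
      have m2 := coeff_mul_add_eq_of_natDegree_le n2 d1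
      rw [show s + 2 = 1 + (s + 1) by ring, m1, show 1 + (s + 1) = 2 + s by ring, m2, k1, k2,
        c1, c2, show 2 * (2 + s) + 1 = 2 * s + 1 + 4 by ring, lucas_add4]
      simp [show 2 * (s + 1) + 1 = 2 * s + 1 + 2 by ring]

open Polynomial in
lemma auxInv (m : ℕ) : ∀ (r : ℕ → ℝ) (p : ℤ[X]),
    ∑ s ∈ Finset.range (m + 1), C (r s) * (auxH s).map (Int.castRingHom ℝ)
      = p.map (Int.castRingHom ℝ) →
    ∀ s ≤ m, ∃ z : ℤ, (∏ j ∈ Finset.Icc s m, (lucas (2 * j + 1) : ℝ)) * r s = z := by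
  have top : ∀ (m : ℕ) (r : ℕ → ℝ) (p : ℤ[X]),
    ∑ s ∈ Finset.range (m + 1), C (r s) * (auxH s).map (Int.castRingHom ℝ)
      = p.map (Int.castRingHom ℝ) → (lucas (2 * m + 1) : ℝ) * r m = (p.coeff m : ℤ) := by
    intro m r p h
    have := congrArg (fun q => coeff q m) h
    simp only [finsetSum_coeff, coeff_C_mul, coeff_map] at this
    rw [Finset.sum_range_succ, Finset.sum_eq_zero, (auxH_deg m).2] at this
    · simp at this
      rw [← this]; ring
    · intro s hs
      rw [coeff_eq_zero_of_natDegree_lt]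
      · simp
      · exact (auxH_deg s).1.trans_lt (by simpa using hs)
  induction m with
  | zero =>
    intro r p h s hs
    obtain rfl : s = 0 := by omega
    exact ⟨p.coeff 0, by simpa using top 0 r p h⟩
  | succ m ih =>
    intro r p h s hs
    have ht := top (m + 1) r p h
    rcases Nat.lt_or_ge m s with h' | h'
    · obtain rfl : s = m + 1 := by omega
      exact ⟨p.coeff (m + 1), by simpa using ht⟩
    · obtain ⟨z, hz⟩ := ih (fun s => lucas (2 * (m + 1) + 1) * r s)
        (C (lucas (2 * (m + 1) + 1) : ℤ) * p - C (p.coeff (m + 1)) * auxH (m + 1)) (by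
          rw [Polynomial.map_sub, Polynomial.map_mul, Polynomial.map_mul, ← h,
            Finset.sum_range_succ _ (m + 1)]
          simp only [map_C, eq_intCast (Int.castRingHom ℝ)]
          rw [← ht, mul_add (C _) (Finset.sum _ _), Finset.mul_sum]
          simp only [C_mul, Int.cast_natCast, mul_assoc]
          ring) s h'
      refine ⟨z, ?_⟩
      rw [← hz, Finset.prod_Icc_succ_top (by omega)]
      ring

/-- The sum of the theorem, as a real number. -/
noncomputable def auxT (m s : ℕ) : ℝ := ∑ k ∈ Finset.range (m + 1),
  (Nat.choose (2 * m + 1) (m - k) : ℝ) * auxA k s / lucas (2 * k + 1)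

open Polynomial in
lemma auxMain_eval (m : ℕ) (w : ℝ) (hw : 0 < w) :
    ∑ s ∈ Finset.range (m + 1), (-1 : ℝ) ^ (m + s) * auxT m s *
      (5 ^ s * ((auxH s).map (Int.castRingHom ℝ)).eval w) = 5 ^ m * w ^ m := by
  obtain ⟨z, hz0, hz⟩ : ∃ z : ℝ, 0 < z ∧ z ^ 2 = 5 * w :=
    ⟨√(5 * w), by positivity, Real.sq_sqrt (by positivity)⟩
  obtain ⟨x, x', hx, hxz⟩ : ∃ x x' : ℝ, x * x' = 1 ∧ x - x' = z := by
    have := Real.sq_sqrt (show 0 ≤ z ^ 2 + 4 by positivity)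
    exact ⟨(√(z ^ 2 + 4) + z) / 2, (√(z ^ 2 + 4) - z) / 2, by linarith, by ring⟩
  obtain ⟨a, b, hab, habz⟩ : ∃ x x' : ℝ, x * x' = 1 ∧ x - x' = 1 := by
    have := Real.sq_sqrt (show (0 : ℝ) ≤ 5 by positivity)
    exact ⟨(√5 + 1) / 2, (√5 - 1) / 2, by linarith, by ring⟩
  have hu : (a * x) * (b * x') = 1 := by linear_combination x * x' * hab + hx
  have hv : (b * x) * (a * x') = 1 := by linear_combination x * x' * hab + hx
  have H := auxH_eval (a * x + b * x') (b * x + a * x') z w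
    (by linear_combination (x - x') * habz + hxz)
    (by
      have : a ^ 2 + b ^ 2 = 3 := by
        linear_combination (a - b + 1) * habz + 2 * hab
      rw [← hxz]
      linear_combination (x ^ 2 + x' ^ 2) * hab + x * x' * this + 5 * hx) hz
  apply mul_left_cancel₀ hz0.ne'
  rw [Finset.mul_sum]
  have st : ∀ s, z * ((-1 : ℝ) ^ (m + s) * auxT m s *
      (5 ^ s * ((auxH s).map (Int.castRingHom ℝ)).eval w))
      = ∑ k ∈ Finset.range (m + 1), (-1 : ℝ) ^ (m + k) * Nat.choose (2 * m + 1) (m - k) /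
        lucas (2 * k + 1) * ((-1) ^ (k + s) * auxA k s *
          ((a * x + b * x') ^ (2 * s + 1) - (b * x + a * x') ^ (2 * s + 1))) := by
    intro s
    rw [← H s, auxT, Finset.mul_sum, Finset.sum_mul, Finset.mul_sum]
    apply Finset.sum_congr rfl
    intro k _
    have : (-1 : ℝ) ^ (m + s) = (-1) ^ (m + k) * (-1) ^ (k + s) := by
      rw [← pow_add, show m + k + (k + s) = m + s + 2 * k by ring, pow_add _ (m + s), pow_mul]
      simp
    rw [this]; ring
  rw [Finset.sum_congr rfl (fun s _ => st s), Finset.sum_comm]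
  rw [← mul_pow, ← hz, ← pow_mul, ← pow_succ', ← hxz, ← auxPow x x' hx m]
  apply Finset.sum_congr rfl
  intro k hk
  have hk' : k < m + 1 := by simpa using hk
  rw [← Finset.mul_sum]
  have hB : ∑ s ∈ Finset.range (m + 1), ((-1 : ℝ) ^ (k + s) * auxA k s *
          ((a * x + b * x') ^ (2 * s + 1) - (b * x + a * x') ^ (2 * s + 1)))
      = lucas (2 * k + 1) * (x ^ (2 * k + 1) - x' ^ (2 * k + 1)) := by
    have B1 := auxB_eq _ _ hu (m + 1) k hk'
    have B2 := auxB_eq _ _ hv (m + 1) k hk'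
    rw [Finset.sum_range_succ, auxA_zero k (m + 1) hk'] at B1 B2
    rw [lucas_eq_s3 a b hab habz]
    calc _ = (a * x + b * x') * (∑ s ∈ Finset.range (m + 1), (-1 : ℝ) ^ (k + s) * auxA k s *
              ((a * x + b * x') ^ 2) ^ s)
            - (b * x + a * x') * (∑ s ∈ Finset.range (m + 1), (-1 : ℝ) ^ (k + s) * auxA k s *
              ((b * x + a * x') ^ 2) ^ s) := by
          rw [Finset.mul_sum, Finset.mul_sum, ← Finset.sum_sub_distrib]
          apply Finset.sum_congr rfl
          intro s _
          rw [pow_succ, pow_succ (b * x + a * x'), pow_mul, pow_mul]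
          ring
      _ = _ := by
          simp only [Nat.cast_zero, mul_zero, zero_mul, add_zero] at B1 B2
          rw [B1, B2]
          simp only [mul_pow]
          ring
  rw [hB]
  have := lucas_pos (2 * k + 1)
  field_simp

open Polynomial in
lemma auxMain (m s : ℕ) (hs : s ≤ m) : ∃ z : ℤ,
    (∏ j ∈ Finset.Icc s m, (lucas (2 * j + 1) : ℝ)) * auxT m s = 5 ^ (m - s) * (z : ℝ) := by
  obtain ⟨z, hz⟩ := auxInv m (fun s => (-1 : ℝ) ^ (m + s) * auxT m s * 5 ^ s / 5 ^ m) (X ^ m) (by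
    apply Polynomial.eq_of_infinite_eval_eq
    apply (Set.Ioi_infinite (0 : ℝ)).mono
    intro w hw
    have := auxMain_eval m w hw
    simp only [Set.mem_ofPred_eq, eval_finsetSum, eval_mul, eval_C, Polynomial.map_pow, map_X,
      eval_pow, eval_X]
    have h5 : (5 : ℝ) ^ m ≠ 0 := by positivity
    apply mul_left_cancel₀ h5
    rw [← this, Finset.mul_sum]
    apply Finset.sum_congr rfl
    intro s _
    field_simp) s hs
  refine ⟨(-1) ^ (m + s) * z, ?_⟩
  obtain ⟨d, rfl⟩ := Nat.exists_eq_add_of_le hs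
  push_cast
  rw [← hz]
  have e : (-1 : ℝ) ^ (s + d + s) * (-1) ^ (s + d + s) = 1 := by rw [← mul_pow]; simp
  rw [show s + d - s = d by omega, pow_add 5 s d]
  field_simp
  rw [pow_two, e, mul_one]

/-- For `0 ≤ s ≤ m`, the number
`L_{2s+1} L_{2s+3} ⋯ L_{2m+1} · ∑_{k=s}^{m} ((1+2k)/(1+2s)) C(2m+1, m-k) C(k+s, 2s) / L_{2k+1}`
is `5^{m-s}` times an integer. -/
theorem five_power_divisibility (m s : ℕ) (hsm : s ≤ m) :
    ∃ z : ℤ,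
      (∏ j ∈ Finset.Icc s m, (lucas (2 * j + 1) : ℚ)) *
        ∑ k ∈ Finset.Icc s m,
          ((1 + 2 * k : ℚ) / (1 + 2 * s)) * (Nat.choose (2 * m + 1) (m - k)) *
            (Nat.choose (k + s) (2 * s)) / (lucas (2 * k + 1)) = 5 ^ (m - s) * (z : ℚ) := by
  obtain ⟨z, hz⟩ := auxMain m s hsm
  refine ⟨z, ?_⟩
  have hT : auxT m s = ∑ k ∈ Finset.Icc s m,
          ((1 + 2 * k : ℝ) / (1 + 2 * s)) * (Nat.choose (2 * m + 1) (m - k)) *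
            (Nat.choose (k + s) (2 * s)) / (lucas (2 * k + 1)) := by
    unfold auxT
    symm
    have hsub : Finset.Icc s m ⊆ Finset.range (m + 1) := by
      intro k hk
      simp only [Finset.mem_Icc, Finset.mem_range] at *
      omega
    rw [← Finset.sum_subset hsub]
    · apply Finset.sum_congr rfl
      intro k hk
      rw [auxA_eq k s (Finset.mem_Icc.1 hk).1]
      ring
    · intro k hk hk'
      simp only [Finset.mem_Icc, Finset.mem_range] at *
      rw [auxA_zero k s (by omega)]; simp
  rw [hT] at hz
  have cast_inj : Function.Injective (Rat.cast : ℚ → ℝ) := Rat.cast_injective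
  apply cast_inj
  push_cast
  exact hz
end

section
/- Fix integers m, s with 0 ≤ s < m, and define f : ℂ → ℂ by f(z) = ∑_{k=s}^{m} ((1+2k)/(1+2s)) · C(2m+1, m-k) · C(k+s, 2s) · (L_{2k+1}(z))^{-1}, where L_{2k+1}(z) denotes the Lucas polynomial evaluated at z. Then for every integer i with 0 ≤ i ≤ m-s-1, the i-th derivative of f vanishes at z = 2i (i.e., iteratedDeriv i f (2·I) = 0, where I is the imaginary unit). -/
open Polynomial Complex

/-- Iterated derivatives commute with a linear substitution. -/
lemma iterDer_comp (p : ℂ[X]) (a : ℂ) (j : ℕ) :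
    derivative^[j] (p.comp (C a * X)) = C (a ^ j) * (derivative^[j] p).comp (C a * X) := by
  induction j generalizing p with
  | zero => simp
  | succ j ih =>
    rw [Function.iterate_succ_apply, Function.iterate_succ_apply, derivative_comp]
    simp only [derivative_mul, derivative_C, derivative_X, zero_mul, zero_add, mul_one]
    rw [iterate_derivative_C_mul, ih, ← mul_assoc, ← C_mul, pow_succ']

lemma iteratedDeriv_eval (p : ℂ[X]) (j : ℕ) :
    iteratedDeriv j (fun z => p.eval z) = fun z => (derivative^[j] p).eval z := by
  induction j generalizing p with
  | zero => simp
  | succ j ih =>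
    rw [iteratedDeriv_succ', Function.iterate_succ_apply, ← ih]
    congr 1
    ext z
    simp

/-- The normalised Lucas polynomial: `T_n(z / (2I))`. -/
noncomputable def nrm (n : ℕ) : ℂ[X] := (Chebyshev.T ℂ n).comp (C ((2 * I)⁻¹) * X)

lemma two_I_ne : (2 * I : ℂ) ≠ 0 := by simp

lemma lucas_eq_s4 (n : ℕ) (z : ℂ) :
    (aeval z (lucasPoly n) : ℂ) = 2 * I ^ n * (nrm n).eval z := by
  induction n using Nat.twoStepInduction with
  | zero =>
    have h : (aeval z (2 : ℤ[X]) : ℂ) = 2 := map_ofNat _ 2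
    simp [lucasPoly, nrm, h]
  | one =>
    simp only [lucasPoly, nrm, Nat.cast_one, Chebyshev.T_one, aeval_X, X_comp, eval_mul, eval_C,
      eval_X, pow_one]
    rw [← mul_assoc, mul_inv_cancel₀ two_I_ne, one_mul]
  | more n h0 h1 =>
    have hT := Chebyshev.T_add_two ℂ (n : ℤ)
    have h2 : (nrm (n + 2)).eval z
        = 2 * ((2 * I)⁻¹ * z) * (nrm (n + 1)).eval z - (nrm n).eval z := by
      simp only [nrm, Nat.cast_add, Nat.cast_ofNat, Nat.cast_one, hT]
      simp
    simp only [lucasPoly, map_add, map_mul, aeval_X, h0, h1, h2]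
    have h3 : (2 * I)⁻¹ = -I / 2 := by
      rw [mul_inv, inv_I]; ring
    rw [h3]
    have hI : I ^ 2 = -1 := I_sq
    rw [pow_add, pow_add, pow_one, hI]
    ring

lemma nrm_eval (n : ℕ) : (nrm n).eval (2 * I) = 1 := by
  simp only [nrm, eval_comp, eval_mul, eval_C, eval_X]
  rw [inv_mul_cancel₀ two_I_ne, Chebyshev.T_eval_one]

lemma nrm_der (j : ℕ) : ∃ Q : ℂ[X], Q.natDegree ≤ j ∧ ∀ n : ℕ,
    (derivative^[j] (nrm n)).eval (2 * I) = Q.eval ((n : ℂ) ^ 2) := by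
  refine ⟨C (((2 * I)⁻¹) ^ j * (∏ l ∈ Finset.range j, (2 * l + 1 : ℂ))⁻¹) *
    ∏ l ∈ Finset.range j, (X - C ((l : ℂ) ^ 2)), ?_, ?_⟩
  · refine (natDegree_C_mul_le _ _).trans ?_
    rw [natDegree_finsetProd_X_sub_C_eq_card]
    simp
  · intro n
    simp only [nrm]
    rw [iterDer_comp]
    simp only [eval_comp, eval_mul, eval_C, eval_X, eval_prod, eval_sub]
    rw [inv_mul_cancel₀ two_I_ne, Chebyshev.iterate_derivative_T_eval_one_eq_div]
    push_cast
    ring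

lemma nrm_contDiff (n : ℕ) (j : WithTop ℕ∞) :
    ContDiffAt ℂ j (fun z => (nrm n).eval z) (2 * I) := by
  simpa using ((nrm n).contDiff_aeval (𝕜 := ℂ) j).contDiffAt (x := 2 * I)

lemma nrm_inv_contDiff (n : ℕ) (j : WithTop ℕ∞) :
    ContDiffAt ℂ j (fun z => ((nrm n).eval z)⁻¹) (2 * I) := by
  refine ContDiffAt.inv (nrm_contDiff n j) ?_
  simp [nrm_eval]

lemma inv_der (j : ℕ) : ∃ Q : ℂ[X], Q.natDegree ≤ j ∧ ∀ n : ℕ,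
    iteratedDeriv j (fun z => ((nrm n).eval z)⁻¹) (2 * I) = Q.eval ((n : ℂ) ^ 2) := by
  induction j using Nat.strong_induction_on with
  | _ j ih =>
    rcases Nat.eq_zero_or_pos j with rfl | hj
    · exact ⟨1, by simp, by intro n; simp [nrm_eval]⟩
    choose! P hP1 hP2 using ih
    choose A hA1 hA2 using nrm_der
    refine ⟨- ∑ l ∈ Finset.range j, C (j.choose l : ℂ) * (P l * A (j - l)), ?_, ?_⟩
    · rw [natDegree_neg]
      refine natDegree_sum_le_of_forall_le _ _ ?_
      intro l hl
      have hl' := Finset.mem_range.mp hl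
      refine (natDegree_C_mul_le _ _).trans (natDegree_mul_le.trans ?_)
      have := hP1 l hl'
      have := hA1 (j - l)
      omega
    · intro n
      have hc : ∀ᶠ z in nhds (2 * I), (nrm n).eval z ≠ 0 :=
        (nrm n).continuous.continuousAt.eventually_ne (by simp [nrm_eval])
      have h1 : (fun z => ((nrm n).eval z)⁻¹ * (nrm n).eval z) =ᶠ[nhds (2 * I)]
          fun _ => (1 : ℂ) := by
        filter_upwards [hc] with z hz
        exact inv_mul_cancel₀ hz
      have h2 := h1.iteratedDeriv_eq j
      rw [iteratedDeriv_const, if_neg hj.ne'] at h2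
      have h3 := iteratedDeriv_fun_mul (n := j) (nrm_inv_contDiff n j)
        (nrm_contDiff n j)
      rw [h3, Finset.sum_range_succ] at h2
      simp only [iteratedDeriv_eval] at h2
      simp only [Nat.choose_self, Nat.sub_self, Function.iterate_zero, id, nrm_eval,
        Nat.cast_one, one_mul, mul_one] at h2
      rw [eq_neg_of_add_eq_zero_right h2]
      simp only [eval_neg, eval_finsetSum, eval_mul, eval_C]
      congr 1
      refine Finset.sum_congr rfl fun l hl => ?_
      rw [hP2 l (Finset.mem_range.mp hl), hA2, mul_assoc]

lemma choose_poly (s : ℕ) : ∃ R : ℂ[X], R.natDegree ≤ s ∧ ∀ k : ℕ,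
    ((k + s).choose (2 * s) : ℂ) = R.eval (((2 * k + 1 : ℕ) : ℂ) ^ 2) := by
  induction s with
  | zero => exact ⟨1, by simp, by simp⟩
  | succ s ih =>
    obtain ⟨R, hR, h⟩ := ih
    refine ⟨C ((4 * (2 * s + 2) * (2 * s + 1) : ℂ)⁻¹) * (R * (X - C ((2 * s + 1 : ℂ) ^ 2))), ?_, ?_⟩
    · refine (natDegree_C_mul_le _ _).trans (natDegree_mul_le.trans ?_)
      rw [natDegree_X_sub_C]
      omega
    · intro k
      simp only [eval_mul, eval_C, eval_sub, eval_X, ← h]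
      have e : ((k + (s + 1)).choose (2 * (s + 1)) : ℂ) * (2 * s + 2) * (2 * s + 1)
          = (k + s).choose (2 * s) * ((k + s + 1) * (k - s)) := by
        have a1 := Nat.add_one_mul_choose_eq (k + s) (2 * s + 1)
        have a2 := Nat.choose_succ_right_eq (k + s) (2 * s)
        rw [show k + (s + 1) = k + s + 1 by ring, show 2 * (s + 1) = 2 * s + 1 + 1 by ring]
        have b1 : ((k + s + 1 : ℂ)) * ((k + s).choose (2 * s + 1) : ℂ)
          = ((k + s + 1).choose (2 * s + 1 + 1) : ℂ) * (2 * s + 1 + 1) := by exact_mod_cast a1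
        have b2 : ((k + s).choose (2 * s + 1) : ℂ) * (2 * s + 1)
          = ((k + s).choose (2 * s) : ℂ) * (k - s) := by
          rcases le_or_gt s k with hk | hk
          · rw [show k + s - 2 * s = k - s by omega] at a2
            rw [← Nat.cast_sub hk]
            exact_mod_cast a2
          · rw [Nat.choose_eq_zero_of_lt (by omega), Nat.choose_eq_zero_of_lt (by omega)]
            simp
        linear_combination (-(2 * s + 1 : ℂ)) * b1 + (k + s + 1 : ℂ) * b2
      have n1 : (2 * s + 2 : ℂ) ≠ 0 := by exact_mod_cast (by omega : 2 * s + 2 ≠ 0)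
      have n2 : (2 * s + 1 : ℂ) ≠ 0 := by exact_mod_cast (by omega : 2 * s + 1 ≠ 0)
      rw [eq_inv_mul_iff_mul_eq₀ (by simp [n1, n2])]
      push_cast
      linear_combination 4 * e

lemma alt_sum (m : ℕ) (Q : ℂ[X]) (hQ : Q.natDegree < m) :
    ∑ k ∈ Finset.range (m + 1), (-1 : ℂ) ^ k * (2 * k + 1) * ((2 * m + 1).choose (m - k)) *
      Q.eval (((2 * k + 1 : ℕ) : ℂ) ^ 2) = 0 := by
  set P : ℂ[X] := (C (-2 : ℂ) * X + C (2 * m + 1 : ℂ)) *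
    Q.comp ((C (-2 : ℂ) * X + C (2 * m + 1 : ℂ)) ^ 2) with hP
  have dlin : (C (-2 : ℂ) * X + C (2 * m + 1 : ℂ)).natDegree ≤ 1 := natDegree_linear_le
  have hdeg : P.natDegree < 2 * m + 1 := by
    refine lt_of_le_of_lt natDegree_mul_le ?_
    have h1 : (Q.comp ((C (-2 : ℂ) * X + C (2 * m + 1 : ℂ)) ^ 2)).natDegree ≤ Q.natDegree * 2 := by
      refine natDegree_comp_le.trans (Nat.mul_le_mul_left _ ?_)
      exact natDegree_pow_le.trans (by omega)
    omega
  have h := congrFun (Polynomial.fwdDiff_iter_eq_zero_of_degree_lt hdeg) 0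
  rw [fwdDiff_iter_eq_sum_shift] at h
  simp only [Pi.zero_apply, zero_add, nsmul_eq_mul, mul_one, zsmul_eq_mul] at h
  rw [show 2 * m + 1 + 1 = (m + 1) + (m + 1) by ring, Finset.sum_range_add,
    ← Finset.sum_range_reflect, ← Finset.sum_add_distrib] at h
  have key : ∀ k ∈ Finset.range (m + 1),
      (-2 * (-1 : ℂ) ^ m) * ((-1 : ℂ) ^ k * (2 * k + 1) * ((2 * m + 1).choose (m - k)) *
      Q.eval (((2 * k + 1 : ℕ) : ℂ) ^ 2)) =
      (((-1 : ℤ) ^ (2 * m + 1 - (m + 1 - 1 - k)) * ((2 * m + 1).choose (m + 1 - 1 - k) : ℤ) : ℤ) : ℂ)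
        * P.eval ((m + 1 - 1 - k : ℕ) : ℂ) +
      (((-1 : ℤ) ^ (2 * m + 1 - (m + 1 + k)) * ((2 * m + 1).choose (m + 1 + k) : ℤ) : ℤ) : ℂ)
        * P.eval ((m + 1 + k : ℕ) : ℂ) := by
    intro k hk
    obtain ⟨d, rfl⟩ := Nat.exists_eq_add_of_le (Nat.lt_succ_iff.mp (Finset.mem_range.mp hk))
    have e1 : P.eval ((k + d + 1 - 1 - k : ℕ) : ℂ)
        = (2 * k + 1) * Q.eval (((2 * k + 1 : ℕ) : ℂ) ^ 2) := by
      rw [show k + d + 1 - 1 - k = d by omega, hP]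
      simp only [eval_mul, eval_add, eval_C, eval_X, eval_comp, eval_pow]
      push_cast
      ring_nf
    have e2 : P.eval ((k + d + 1 + k : ℕ) : ℂ)
        = -((2 * k + 1) * Q.eval (((2 * k + 1 : ℕ) : ℂ) ^ 2)) := by
      rw [hP]
      simp only [eval_mul, eval_add, eval_C, eval_X, eval_comp, eval_pow]
      push_cast
      ring_nf
    have c1 : (2 * (k + d) + 1).choose (k + d + 1 + k) = (2 * (k + d) + 1).choose d :=
      Nat.choose_symm_of_eq_add (by omega)
    rw [e1, e2, c1, show k + d + 1 - 1 - k = d by omega, show k + d - k = d by omega,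
      show 2 * (k + d) + 1 - d = k + k + d + 1 by omega,
      show 2 * (k + d) + 1 - (k + d + 1 + k) = d by omega]
    push_cast
    have hk2 : (-1 : ℂ) ^ k * (-1) ^ k = 1 := by rw [← mul_pow]; simp
    simp only [pow_add, pow_one, hk2]
    linear_combination (-2 * (-1 : ℂ) ^ d * (2 * k + 1) * ((2 * (k + d) + 1).choose d : ℂ) *
      Q.eval ((2 * k + 1 : ℂ) ^ 2)) * hk2
  have h' := (Finset.sum_congr rfl key).trans h
  rw [← Finset.mul_sum] at h'
  exact (mul_eq_zero.mp h').resolve_left (by simp)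

/-- For `0 ≤ s < m` and `f(z) = ∑_{k=s}^{m} ((1+2k)/(1+2s)) C(2m+1, m-k) C(k+s, 2s) / L_{2k+1}(z)`,
the `i`-th derivative of `f` vanishes at `z = 2I` for every `0 ≤ i ≤ m - s - 1`. -/
theorem derivatives_vanish_at_two_I (m s : ℕ) (hsm : s < m) (i : ℕ) (hi : i ≤ m - s - 1) :
    iteratedDeriv i
      (fun z : ℂ => ∑ k ∈ Finset.Icc s m,
        ((1 + 2 * k : ℂ) / (1 + 2 * s)) * (Nat.choose (2 * m + 1) (m - k)) *
          (Nat.choose (k + s) (2 * s)) * ((aeval z (lucasPoly (2 * k + 1)) : ℂ))⁻¹)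
      (2 * I) = 0 := by
  obtain ⟨P, hP, hPe⟩ := inv_der i
  obtain ⟨R, hR, hRe⟩ := choose_poly s
  have hterm : ∀ k : ℕ, ∀ z : ℂ, ((1 + 2 * k : ℂ) / (1 + 2 * s)) *
      (Nat.choose (2 * m + 1) (m - k)) * (Nat.choose (k + s) (2 * s)) *
        ((aeval z (lucasPoly (2 * k + 1)) : ℂ))⁻¹ =
      (((1 + 2 * s : ℂ)⁻¹ * (2 * I)⁻¹) * ((-1 : ℂ) ^ k * (2 * k + 1) *
        (Nat.choose (2 * m + 1) (m - k)) * (Nat.choose (k + s) (2 * s)))) *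
        ((nrm (2 * k + 1)).eval z)⁻¹ := by
    intro k z
    have hI : (2 * I ^ (2 * k + 1))⁻¹ = (2 * I)⁻¹ * (-1 : ℂ) ^ k := by
      rw [pow_succ, pow_mul, I_sq, mul_inv, mul_inv, mul_inv, ← inv_pow]
      norm_num
      ring
    rw [lucas_eq_s4, mul_inv (2 * I ^ (2 * k + 1)), hI, div_eq_mul_inv]
    ring
  simp only [hterm]
  rw [iteratedDeriv_fun_sum
    (fun k _ => contDiffAt_const.mul (nrm_inv_contDiff (2 * k + 1) i))]
  simp only [iteratedDeriv_const_mul_field, hPe]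
  have hdeg : (R * P).natDegree < m := by
    refine lt_of_le_of_lt natDegree_mul_le ?_
    omega
  have hsum := alt_sum m (R * P) hdeg
  simp only [eval_mul, ← hRe] at hsum
  have hsub : Finset.Icc s m ⊆ Finset.range (m + 1) := by
    intro k hk
    have := Finset.mem_Icc.mp hk
    exact Finset.mem_range.mpr (by omega)
  rw [Finset.sum_subset hsub]
  · rw [← mul_zero ((1 + 2 * s : ℂ)⁻¹ * (2 * I)⁻¹), ← hsum, Finset.mul_sum]
    refine Finset.sum_congr rfl fun k _ => ?_
    ring
  · intro k hk hk'
    have h1 := Finset.mem_range.mp hk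
    have h2 : k < s := by
      by_contra hc
      exact hk' (Finset.mem_Icc.mpr ⟨by omega, by omega⟩)
    rw [Nat.choose_eq_zero_of_lt (by omega : k + s < 2 * s)]
    simp
end

section
/- Let I denote the imaginary unit in ℂ. For every integer n ≥ 0, L_n(2I) = 2·I^n, where L_n is the Lucas polynomial regarded as a function ℂ → ℂ. Moreover, for every integer n ≥ 1 and every integer j with 1 ≤ j ≤ n, the j-th derivative of L_n at 2I equals n · (j-1)! · I^{n-j} · C(n+j-1, 2j-1). -/
open Polynomial Complex

/-- Normalized derivative values. -/
def lucasE : ℕ → ℕ → ℂ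
  | _, 0 => 2
  | n, j + 1 => (n : ℂ) * (Nat.factorial j) * (Nat.choose (n + j) (2 * j + 1))

lemma lucasE_rec (n j : ℕ) :
    lucasE (n + 2) (j + 1) =
      2 * lucasE (n + 1) (j + 1) + (j + 1) * lucasE (n + 1) j - lucasE n (j + 1) := by
  rcases j with _ | k
  · simp [lucasE]; ring
  · have key : (Nat.choose (n + k + 1) (2 * k + 2) : ℂ) * (2 * k + 2)
        = Nat.choose (n + k + 1) (2 * k + 1) * ((n : ℂ) - k) := by
      rcases le_or_gt k n with h | h
      · have := Nat.choose_succ_right_eq (n + k + 1) (2 * k + 1)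
        rw [show n + k + 1 - (2 * k + 1) = n - k by omega] at this
        have h2 := congrArg (Nat.cast : ℕ → ℂ) this
        push_cast [Nat.cast_sub h] at h2
        rw [← h2]; ring
      · rw [Nat.choose_eq_zero_of_lt (by omega), Nat.choose_eq_zero_of_lt (by omega)]; simp
    have e2 : Nat.choose (n + k + 2) (2 * k + 3) =
        Nat.choose (n + k + 1) (2 * k + 2) + Nat.choose (n + k + 1) (2 * k + 3) :=
      Nat.choose_succ_succ _ _
    have e1 : Nat.choose (n + k + 2) (2 * k + 2) =
        Nat.choose (n + k + 1) (2 * k + 1) + Nat.choose (n + k + 1) (2 * k + 2) :=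
      Nat.choose_succ_succ _ _
    have e3 : Nat.choose (n + k + 3) (2 * k + 3) =
        Nat.choose (n + k + 2) (2 * k + 2) + Nat.choose (n + k + 2) (2 * k + 3) :=
      Nat.choose_succ_succ _ _
    simp only [lucasE]
    rw [show n + 2 + (k + 1) = n + k + 3 by ring, show n + 1 + (k + 1) = n + k + 2 by ring,
      show n + 1 + k = n + k + 1 by ring, show n + (k + 1) = n + k + 1 by ring,
      show 2 * (k + 1) + 1 = 2 * k + 3 by ring, e3, e1, e2, Nat.factorial_succ]
    push_cast
    linear_combination (Nat.factorial k : ℂ) * key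

lemma lucas_deriv (n : ℕ) : ∀ j : ℕ,
    I ^ j * (aeval (2 * I) (derivative^[j] (lucasPoly n)) : ℂ) = I ^ n * lucasE n j := by
  induction n using Nat.twoStepInduction with
  | zero =>
    intro j
    rcases j with _ | j
    · simp [lucasPoly, lucasE]; exact map_ofNat (aeval (2 * I)) 2
    · have : derivative^[j + 1] (2 : ℤ[X]) = 0 := by
        rw [Function.iterate_succ_apply, derivative_ofNat, iterate_derivative_zero]
      simp [lucasPoly, lucasE, this]
  | one =>
    intro j
    rcases j with _ | _ | j
    · simp [lucasPoly, lucasE]; ring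
    · simp [lucasPoly, lucasE]
    · have : derivative^[j + 2] (X : ℤ[X]) = 0 := by
        rw [Function.iterate_succ_apply, Function.iterate_succ_apply]; simp
      simp only [lucasPoly, this, lucasE]
      rw [Nat.choose_eq_zero_of_lt (by omega)]; simp
  | more n ih0 ih1 =>
    intro j
    rcases j with _ | j
    · have h0 := ih0 0
      have h1 := ih1 0
      simp [lucasE] at h0 h1
      simp [lucasPoly, lucasE, h0, h1]
      linear_combination (2 * I ^ n) * I_sq
    · have h0 := ih0 (j + 1)
      have h1 := ih1 (j + 1)
      have h2 := ih1 j
      have hd : derivative^[j + 1] (X * lucasPoly (n + 1)) =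
          X * derivative^[j + 1] (lucasPoly (n + 1))
            + (j + 1 : ℕ) • derivative^[j] (lucasPoly (n + 1)) := by
        generalize lucasPoly (n + 1) = p
        clear * -
        induction j with
        | zero => simp; ring
        | succ j ih =>
          rw [Function.iterate_succ_apply', ih]
          simp only [derivative_add, derivative_mul, derivative_X, derivative_smul,
            ← Function.iterate_succ_apply' (derivative (R := ℤ))]
          simp only [nsmul_eq_mul]
          push_cast
          ring
      rw [lucasE_rec, lucasPoly, iterate_map_add, hd]
      simp only [map_add, map_mul, aeval_X, map_natCast, map_one, Nat.cast_add, Nat.cast_one, nsmul_eq_mul]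
      linear_combination h0 + 2 * I * h1 + (j + 1) * I * h2 + (I ^ n * lucasE n (j + 1)) * I_sq

lemma lucas_iter (p : ℤ[X]) (j : ℕ) :
    iteratedDeriv j (fun z : ℂ => (aeval z p : ℂ)) =
      fun z : ℂ => (aeval z (derivative^[j] p) : ℂ) := by
  induction j with
  | zero => simp
  | succ j ih =>
    rw [iteratedDeriv_succ, ih, Function.iterate_succ_apply']
    funext z
    exact Polynomial.deriv_aeval _

/-- `L_n(2I) = 2 I^n` for all `n ≥ 0`, and for `1 ≤ j ≤ n` the `j`-th derivative of `L_n`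
at `2I` equals `n (j-1)! I^{n-j} C(n+j-1, 2j-1)`. -/
theorem lucasPoly_at_two_I :
    (∀ n : ℕ, (aeval (2 * I) (lucasPoly n) : ℂ) = 2 * I ^ n) ∧
      ∀ n : ℕ, 1 ≤ n → ∀ j : ℕ, 1 ≤ j → j ≤ n →
        iteratedDeriv j (fun z : ℂ => (aeval z (lucasPoly n) : ℂ)) (2 * I) =
          (n : ℂ) * (Nat.factorial (j - 1)) * I ^ (n - j) *
            (Nat.choose (n + j - 1) (2 * j - 1)) := by
  constructor
  · intro n
    have := lucas_deriv n 0
    simp [lucasE] at this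
    rw [this]; ring
  · intro n hn j hj hjn
    obtain ⟨k, rfl⟩ : ∃ k, j = k + 1 := ⟨j - 1, by omega⟩
    obtain ⟨m, rfl⟩ : ∃ m, n = m + (k + 1) := ⟨n - (k + 1), by omega⟩
    rw [lucas_iter]
    have h := lucas_deriv (m + (k + 1)) (k + 1)
    apply mul_left_cancel₀ (pow_ne_zero (k + 1) I_ne_zero)
    rw [h]
    simp only [lucasE]
    rw [show m + (k + 1) + (k + 1) - 1 = m + (k + 1) + k by omega,
      show 2 * (k + 1) - 1 = 2 * k + 1 by omega, Nat.add_sub_cancel, Nat.add_sub_cancel, pow_add]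
    ring
end

section
/- For every integer k ≥ 0, the identity ∑_{i=0}^{k} ((2k+1)/(2i+1)) · C(k+i, 2i) · x^{2i+1} = L_{2k+1}(x) holds in the ring of polynomials with rational coefficients; equivalently, ∑_{i=0}^{k} x^{2i+1}/(2i+1) · C(k+i, 2i) = L_{2k+1}(x)/(2k+1). -/
open Polynomial

noncomputable def fibA (N k : ℕ) : Polynomial ℚ :=
  ∑ i ∈ Finset.range N, (Nat.choose (k + i) (2 * i) : Polynomial ℚ) * X ^ (2 * i)

noncomputable def fibB (N k : ℕ) : Polynomial ℚ :=
  ∑ i ∈ Finset.range N, (Nat.choose (k + i) (2 * i + 1) : Polynomial ℚ) * X ^ (2 * i + 1)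

lemma fibB_succ (N k : ℕ) : fibB N (k + 1) = X * fibA N k + fibB N k := by
  unfold fibA fibB
  rw [Finset.mul_sum, ← Finset.sum_add_distrib]
  refine Finset.sum_congr rfl fun i _ => ?_
  rw [show k + 1 + i = (k + i) + 1 by ring, Nat.choose_succ_succ']
  push_cast
  ring

lemma fibB_range (N k : ℕ) (h : k ≤ N) : fibB (N + 1) k = fibB N k := by
  unfold fibB
  rw [Finset.sum_range_succ, Nat.choose_eq_zero_of_lt (by omega)]
  simp

lemma fibA_succ (N k : ℕ) (h : k + 1 ≤ N) :
    fibA (N + 1) (k + 1) = X * fibB (N + 1) (k + 1) + fibA (N + 1) k := by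
  rw [fibB_range N _ h]
  unfold fibA fibB
  rw [Finset.sum_range_succ', Finset.sum_range_succ', Finset.mul_sum, ← add_assoc,
    ← Finset.sum_add_distrib]
  congr 1
  · refine Finset.sum_congr rfl fun i _ => ?_
    rw [show k + 1 + (i + 1) = (k + 1 + i) + 1 by ring, show 2 * (i + 1) = (2 * i + 1) + 1 by ring,
      Nat.choose_succ_succ', show k + (i + 1) = k + 1 + i by ring]
    push_cast
    ring
  · simp

lemma fib_zero (N : ℕ) : fibA (N + 1) 0 = 1 ∧ fibB (N + 1) 0 = 0 := by
  unfold fibA fibB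
  constructor
  · rw [Finset.sum_range_succ', Finset.sum_eq_zero]
    · simp
    · intro i _
      rw [Nat.choose_eq_zero_of_lt (by omega)]
      simp
  · apply Finset.sum_eq_zero
    intro i _
    rw [Nat.choose_eq_zero_of_lt (by omega)]
    simp

lemma lucas_fib (N k : ℕ) (h : k ≤ N) :
    (lucasPoly (2 * k)).map (Int.castRingHom ℚ) = 2 * fibA (N + 1) k - X * fibB (N + 1) k ∧
    (lucasPoly (2 * k + 1)).map (Int.castRingHom ℚ) = X * fibA (N + 1) k + 2 * fibB (N + 1) k := by
  induction k with
  | zero =>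
    obtain ⟨h1, h2⟩ := fib_zero N
    rw [h1, h2]
    simp [lucasPoly]
  | succ k ih =>
    obtain ⟨h1, h2⟩ := ih (by omega)
    have e1 : (lucasPoly (2 * (k + 1))).map (Int.castRingHom ℚ) =
        X * (lucasPoly (2 * k + 1)).map (Int.castRingHom ℚ)
          + (lucasPoly (2 * k)).map (Int.castRingHom ℚ) := by
      rw [show 2 * (k + 1) = 2 * k + 2 by ring, lucasPoly]
      simp
    have e2 : (lucasPoly (2 * (k + 1) + 1)).map (Int.castRingHom ℚ) =
        X * (lucasPoly (2 * (k + 1))).map (Int.castRingHom ℚ)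
          + (lucasPoly (2 * k + 1)).map (Int.castRingHom ℚ) := by
      rw [show 2 * (k + 1) + 1 = (2 * k + 1) + 2 by ring, lucasPoly]
      simp [show 2 * (k + 1) = 2 * k + 1 + 1 by ring]
    rw [e2, e1, h1, h2, fibA_succ N k h, fibB_succ]
    constructor <;> ring

/-- `∑_{i=0}^{k} ((2k+1)/(2i+1)) C(k+i, 2i) x^{2i+1} = L_{2k+1}(x)` in `ℚ[x]`. -/
theorem lucasPoly_odd_expansion (k : ℕ) :
    ∑ i ∈ Finset.range (k + 1),
        C (((2 * k + 1 : ℚ) / (2 * i + 1)) * (Nat.choose (k + i) (2 * i))) * X ^ (2 * i + 1) =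
      (lucasPoly (2 * k + 1)).map (Int.castRingHom ℚ) := by
  rw [(lucas_fib k k le_rfl).2]
  unfold fibA fibB
  rw [Finset.mul_sum, Finset.mul_sum, ← Finset.sum_add_distrib]
  refine Finset.sum_congr rfl fun i hi => ?_
  have hik : i ≤ k := by
    have := Finset.mem_range.mp hi
    omega
  have key : ((2 * k + 1 : ℚ) / (2 * i + 1)) * (Nat.choose (k + i) (2 * i)) =
      Nat.choose (k + i) (2 * i) + 2 * Nat.choose (k + i) (2 * i + 1) := by
    have h := Nat.choose_succ_right_eq (k + i) (2 * i)
    rw [show k + i - 2 * i = k - i by omega] at h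
    have h' : (Nat.choose (k + i) (2 * i + 1) : ℚ) * (2 * i + 1) =
        Nat.choose (k + i) (2 * i) * (k - i) := by
      rw [← Nat.cast_sub hik]
      exact_mod_cast h
    have hne : (2 * i + 1 : ℚ) ≠ 0 := by positivity
    rw [div_mul_eq_mul_div, div_eq_iff hne]
    linear_combination -2 * h'
  rw [key]
  simp only [map_add, map_mul, map_natCast, map_ofNat]
  ring
end

section
/- For every integer k ≥ 0, the identity ∑_{i=0}^{k} ((2k+1)/(2i+1)) · (-1)^i · (x^2+4)^i · C(k+i, 2i) = (-1)^k · F_{2k+1}(x) holds in the ring of polynomials with rational coefficients; equivalently, ∑_{i=0}^{k} (-1)^i (x^2+4)^i / (2i+1) · C(k+i, 2i) = (-1)^k F_{2k+1}(x)/(2k+1). -/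
open Polynomial

/-- The Fibonacci polynomials: `F 0 = 0`, `F 1 = 1`, `F (n+2) = X * F (n+1) + F n`. -/
noncomputable def fibPoly : ℕ → Polynomial ℤ
  | 0 => 0
  | 1 => 1
  | n + 2 => X * fibPoly (n + 1) + fibPoly n

/-- Integral form of the coefficients. -/
def fibCoef (k i : ℕ) : ℕ := (k + i).choose (2 * i) + 2 * (k + i).choose (2 * i + 1)

theorem fibCoef_eq (k i : ℕ) :
    ((2 * k + 1 : ℚ) / (2 * i + 1)) * (Nat.choose (k + i) (2 * i)) = fibCoef k i := by
  unfold fibCoef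
  have h0 : (2 * i + 1 : ℚ) ≠ 0 := by positivity
  rcases le_or_gt i k with h | h
  · have h1 := Nat.choose_succ_right_eq (k + i) (2 * i)
    have h2 : k + i - 2 * i = k - i := by omega
    rw [h2] at h1
    have h3 : ((k + i).choose (2 * i + 1) : ℚ) * (2 * i + 1) = (k + i).choose (2 * i) * (k - i) := by
      rw [← Nat.cast_sub h]
      exact_mod_cast h1
    push_cast
    field_simp
    linear_combination (-2) * h3
  · rw [Nat.choose_eq_zero_of_lt (by omega : k + i < 2 * i),
      Nat.choose_eq_zero_of_lt (by omega : k + i < 2 * i + 1)]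
    simp

theorem fibCoef_rec (k i : ℕ) :
    fibCoef (k + 2) (i + 1) + fibCoef k (i + 1) = 2 * fibCoef (k + 1) (i + 1) + fibCoef (k + 1) i := by
  have key : ∀ n m : ℕ, (n + 2).choose (m + 2) + n.choose (m + 2)
      = 2 * (n + 1).choose (m + 2) + n.choose m := by
    intro n m
    have := Nat.choose_succ_succ' (n + 1) (m + 1)
    have := Nat.choose_succ_succ' n (m + 1)
    have := Nat.choose_succ_succ' n m
    simp only [add_assoc, Nat.reduceAdd] at *
    omega
  have h1 := key (k + i + 1) (2 * i)
  have h2 := key (k + i + 1) (2 * i + 1)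
  unfold fibCoef
  have e1 : k + 2 + (i + 1) = k + i + 1 + 2 := by ring
  have e2 : k + (i + 1) = k + i + 1 := by ring
  have e3 : k + 1 + (i + 1) = k + i + 1 + 1 := by ring
  have e4 : k + 1 + i = k + i + 1 := by ring
  have e5 : 2 * (i + 1) = 2 * i + 2 := by ring
  have e6 : 2 * i + 2 + 1 = 2 * i + 1 + 2 := by ring
  rw [e1, e2, e3, e4, e5, e6]
  omega

theorem fibCoef_zero_of_lt (k i : ℕ) (h : k < i) : fibCoef k i = 0 := by
  unfold fibCoef
  rw [Nat.choose_eq_zero_of_lt (by omega : k + i < 2 * i),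
      Nat.choose_eq_zero_of_lt (by omega : k + i < 2 * i + 1)]

theorem fibSum_extend (y : ℚ[X]) (k N : ℕ) (h : k + 1 ≤ N) :
    ∑ i ∈ Finset.range (k + 1), (fibCoef k i : ℚ[X]) * (-y) ^ i =
      ∑ i ∈ Finset.range N, (fibCoef k i : ℚ[X]) * (-y) ^ i := by
  apply Finset.sum_subset
  · intro i hi
    simp only [Finset.mem_range] at *
    omega
  · intro i _ hi
    simp only [Finset.mem_range] at *
    rw [fibCoef_zero_of_lt k i (by omega)]
    simp

theorem fibSum_rec (y : ℚ[X]) (k : ℕ) :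
    ∑ i ∈ Finset.range (k + 2 + 1), (fibCoef (k + 2) i : ℚ[X]) * (-y) ^ i =
      (2 - y) * ∑ i ∈ Finset.range (k + 1 + 1), (fibCoef (k + 1) i : ℚ[X]) * (-y) ^ i
      - ∑ i ∈ Finset.range (k + 1), (fibCoef k i : ℚ[X]) * (-y) ^ i := by
  have hs : ∀ j, ∑ i ∈ Finset.range (k + 2 + 1), (fibCoef j i : ℚ[X]) * (-y) ^ i =
      ∑ i ∈ Finset.range (k + 2), (fibCoef j (i + 1) : ℚ[X]) * (-y) ^ (i + 1) + (2 * j + 1) := by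
    intro j
    rw [Finset.sum_range_succ']
    simp [fibCoef]
    ring
  have hr : ∑ i ∈ Finset.range (k + 2), (fibCoef (k + 2) (i + 1) : ℚ[X]) * (-y) ^ (i + 1)
      + ∑ i ∈ Finset.range (k + 2), (fibCoef k (i + 1) : ℚ[X]) * (-y) ^ (i + 1)
      = 2 * ∑ i ∈ Finset.range (k + 2), (fibCoef (k + 1) (i + 1) : ℚ[X]) * (-y) ^ (i + 1)
      + (-y) * ∑ i ∈ Finset.range (k + 2), (fibCoef (k + 1) i : ℚ[X]) * (-y) ^ i := by
    rw [Finset.mul_sum, Finset.mul_sum, ← Finset.sum_add_distrib, ← Finset.sum_add_distrib]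
    refine Finset.sum_congr rfl fun i _ => ?_
    have h : ((fibCoef (k + 2) (i + 1) : ℚ[X]) + fibCoef k (i + 1))
        = 2 * fibCoef (k + 1) (i + 1) + fibCoef (k + 1) i := by
      exact_mod_cast congrArg (Nat.cast : ℕ → ℚ[X]) (fibCoef_rec k i)
    linear_combination (-y) ^ (i + 1) * h
  have h0 := hs (k + 2)
  have h1 := hs (k + 1)
  have h2 := hs k
  rw [← fibSum_extend y k _ (by omega)] at h2
  rw [← fibSum_extend y (k + 1) _ (by omega)] at h1
  push_cast at h0 h1 h2
  linear_combination h0 + h2 - 2 * h1 + hr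

theorem fibSum_eq (k : ℕ) :
    ∑ i ∈ Finset.range (k + 1), (fibCoef k i : ℚ[X]) * (-(X ^ 2 + 4)) ^ i =
      (-1) ^ k * (fibPoly (2 * k + 1)).map (Int.castRingHom ℚ) := by
  induction k using Nat.twoStepInduction with
  | zero => simp [fibCoef, fibPoly]
  | one =>
    simp [Finset.sum_range_succ, fibCoef, fibPoly]
    ring
  | more k h0 h1 =>
    rw [fibSum_rec, h0, h1]
    have e1 : 2 * (k + 2) + 1 = 2 * k + 1 + 2 + 2 := by ring
    have e2 : 2 * (k + 1) + 1 = 2 * k + 1 + 2 := by ring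
    rw [e1, e2]
    have r : ∀ n, (fibPoly (n + 2)).map (Int.castRingHom ℚ) =
        X * (fibPoly (n + 1)).map (Int.castRingHom ℚ) + (fibPoly n).map (Int.castRingHom ℚ) := by
      intro n
      simp [fibPoly]
    have r0 := r (2 * k + 1)
    have r1 := r (2 * k + 1 + 1)
    have r2 := r (2 * k + 1 + 2)
    simp only [add_assoc, Nat.reduceAdd] at *
    rw [r2, r1, r0]
    ring

/-- `∑_{i=0}^{k} ((2k+1)/(2i+1)) (-1)^i (x^2+4)^i C(k+i, 2i) = (-1)^k F_{2k+1}(x)` in `ℚ[x]`. -/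
theorem fibPoly_odd_expansion (k : ℕ) :
    ∑ i ∈ Finset.range (k + 1),
        C (((2 * k + 1 : ℚ) / (2 * i + 1)) * (-1 : ℚ) ^ i * (Nat.choose (k + i) (2 * i))) *
          (X ^ 2 + C 4) ^ i =
      C ((-1 : ℚ) ^ k) * (fibPoly (2 * k + 1)).map (Int.castRingHom ℚ) := by
  have h := fibSum_eq k
  have e : C ((-1 : ℚ) ^ k) = (-1) ^ k := by simp
  rw [e, ← h]
  refine Finset.sum_congr rfl fun i _ => ?_
  have e4 : (C 4 : ℚ[X]) = 4 := rfl
  rw [mul_right_comm, fibCoef_eq, neg_pow (X ^ 2 + 4 : ℚ[X]), e4]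
  simp
  ring
end

section
/- For every integer k ≥ 0, the identity x · ∑_{i=0}^{k} (-1)^i · (x^2+4)^i · C(k+i, 2i) = (-1)^k · L_{2k+1}(x) holds in the ring of polynomials with integer coefficients. -/
open Polynomial

theorem lucas_aux_T (k : ℕ) (y : ℤ[X]) :
    ∑ i ∈ Finset.range (k + 2), (-y) ^ i * ((k + 1 + i).choose (2 * i + 1) : ℤ[X]) =
      ∑ i ∈ Finset.range (k + 1), (-y) ^ i * ((k + i).choose (2 * i + 1) : ℤ[X]) +
      ∑ i ∈ Finset.range (k + 1), (-y) ^ i * ((k + i).choose (2 * i) : ℤ[X]) := by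
  rw [Finset.sum_range_succ, Nat.choose_eq_zero_of_lt (by omega : k + 1 + (k + 1) < 2 * (k + 1) + 1),
    ← Finset.sum_add_distrib]
  simp only [Nat.cast_zero, mul_zero, add_zero]
  refine Finset.sum_congr rfl fun i _ => ?_
  rw [show k + 1 + i = (k + i) + 1 by ring, Nat.choose_succ_succ]
  push_cast
  ring

theorem lucas_aux_S (k : ℕ) (y : ℤ[X]) :
    ∑ i ∈ Finset.range (k + 2), (-y) ^ i * ((k + 1 + i).choose (2 * i) : ℤ[X]) =
      ∑ i ∈ Finset.range (k + 1), (-y) ^ i * ((k + i).choose (2 * i) : ℤ[X]) -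
      y * ∑ i ∈ Finset.range (k + 2), (-y) ^ i * ((k + 1 + i).choose (2 * i + 1) : ℤ[X]) := by
  have h1 : ∑ i ∈ Finset.range (k + 1), (-y) ^ i * ((k + i).choose (2 * i) : ℤ[X]) =
      ∑ i ∈ Finset.range (k + 2), (-y) ^ i * ((k + i).choose (2 * i) : ℤ[X]) := by
    rw [Finset.sum_range_succ _ (k + 1),
      Nat.choose_eq_zero_of_lt (by omega : k + (k + 1) < 2 * (k + 1))]
    simp
  have h2 : ∑ i ∈ Finset.range (k + 2), (-y) ^ i * ((k + 1 + i).choose (2 * i + 1) : ℤ[X]) =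
      ∑ i ∈ Finset.range (k + 1), (-y) ^ i * ((k + 1 + i).choose (2 * i + 1) : ℤ[X]) := by
    rw [Finset.sum_range_succ _ (k + 1),
      Nat.choose_eq_zero_of_lt (by omega : k + 1 + (k + 1) < 2 * (k + 1) + 1)]
    simp
  rw [h1, h2, Finset.sum_range_succ', Finset.sum_range_succ' _ (k + 1), Finset.mul_sum,
    add_sub_right_comm, ← Finset.sum_sub_distrib]
  congr 1
  · refine Finset.sum_congr rfl fun i _ => ?_
    rw [show k + 1 + (i + 1) = (k + 1 + i) + 1 by ring, show 2 * (i + 1) = (2 * i + 1) + 1 by ring,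
      Nat.choose_succ_succ, show k + (i + 1) = k + 1 + i by ring]
    push_cast
    ring
  · simp

theorem lucas_aux (k : ℕ) :
    X * ∑ i ∈ Finset.range (k + 1), (-(X ^ 2 + 4 : ℤ[X])) ^ i * ((k + i).choose (2 * i) : ℤ[X]) =
      (-1) ^ k * lucasPoly (2 * k + 1) ∧
    (X ^ 2 + 4) * X * ∑ i ∈ Finset.range (k + 1),
        (-(X ^ 2 + 4 : ℤ[X])) ^ i * ((k + i).choose (2 * i + 1) : ℤ[X]) =
      (-1) ^ (k + 1) * (2 * lucasPoly (2 * k + 1) - X * lucasPoly (2 * k)) := by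
  induction k with
  | zero => simp [lucasPoly]; ring
  | succ k ih =>
    obtain ⟨hS, hT⟩ := ih
    have e2 : lucasPoly (2 * (k + 1)) = X * lucasPoly (2 * k + 1) + lucasPoly (2 * k) := by
      rw [show 2 * (k + 1) = 2 * k + 2 by ring, lucasPoly]
    have e3 : lucasPoly (2 * (k + 1) + 1) =
        X * lucasPoly (2 * (k + 1)) + lucasPoly (2 * k + 1) := by
      rw [show 2 * (k + 1) + 1 = (2 * k + 1) + 2 by ring, lucasPoly]; rfl
    rw [lucas_aux_S, lucas_aux_T, e3, e2]
    constructor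
    · linear_combination (1 - (X ^ 2 + 4)) * hS - hT
    · linear_combination (X ^ 2 + 4) * hS + hT

/-- `x ∑_{i=0}^{k} (-1)^i (x^2+4)^i C(k+i, 2i) = (-1)^k L_{2k+1}(x)` in `ℤ[x]`. -/
theorem lucasPoly_odd_identity (k : ℕ) :
    X * ∑ i ∈ Finset.range (k + 1),
        C ((-1 : ℤ) ^ i * (Nat.choose (k + i) (2 * i))) * (X ^ 2 + C 4) ^ i =
      C ((-1 : ℤ) ^ k) * lucasPoly (2 * k + 1) := by
  have h := (lucas_aux k).1
  have h4 : (C 4 : ℤ[X]) = 4 := rfl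
  have hk : (C ((-1 : ℤ) ^ k) : ℤ[X]) = (-1) ^ k := by simp
  rw [hk, ← h, h4]
  congr 1
  refine Finset.sum_congr rfl fun i _ => ?_
  rw [neg_pow (X ^ 2 + 4 : ℤ[X]) i, C_mul]
  have hi : (C ((-1 : ℤ) ^ i) : ℤ[X]) = (-1) ^ i := by simp
  have hc : (C (((k + i).choose (2 * i) : ℕ) : ℤ) : ℤ[X]) = ((k + i).choose (2 * i) : ℤ[X]) := by
    simp
  rw [hi, hc]
  ring
end

section
/- For every integer k ≥ 0, the identity ∑_{i=0}^{k} C(k+i, 2i) · x^{2i} = F_{2k+1}(x) holds in the ring of polynomials with integer coefficients. -/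
open Polynomial

theorem fibPoly_expansion_aux (k : ℕ) :
    (∑ i ∈ Finset.range (k + 1), C ((Nat.choose (k + i) (2 * i) : ℤ)) * X ^ (2 * i) =
      fibPoly (2 * k + 1)) ∧
    (∑ i ∈ Finset.range k, C ((Nat.choose (k + i) (2 * i + 1) : ℤ)) * X ^ (2 * i + 1) =
      fibPoly (2 * k)) := by
  induction k with
  | zero => simp [fibPoly]
  | succ k ih =>
    obtain ⟨h1, h2⟩ := ih
    have e2 : fibPoly (2 * (k + 1)) = X * fibPoly (2 * k + 1) + fibPoly (2 * k) := by
      rw [show 2 * (k + 1) = 2 * k + 2 by ring, fibPoly]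
    have e1 : fibPoly (2 * (k + 1) + 1) = X * fibPoly (2 * (k + 1)) + fibPoly (2 * k + 1) := by
      rw [show 2 * (k + 1) + 1 = (2 * k + 1) + 2 by ring, fibPoly]
      rfl
    have h2' : ∑ i ∈ Finset.range (k + 1),
        C ((Nat.choose (k + i) (2 * i + 1) : ℤ)) * X ^ (2 * i + 1) = fibPoly (2 * k) := by
      rw [Finset.sum_range_succ, h2, Nat.choose_eq_zero_of_lt (by omega)]
      simp
    have t : ∑ i ∈ Finset.range (k + 1),
        C ((Nat.choose (k + 1 + i) (2 * i + 1) : ℤ)) * X ^ (2 * i + 1) =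
          fibPoly (2 * (k + 1)) := by
      rw [e2, ← h1, ← h2', Finset.mul_sum, ← Finset.sum_add_distrib]
      refine Finset.sum_congr rfl fun i _ => ?_
      rw [show k + 1 + i = (k + i) + 1 by ring, Nat.choose_succ_succ']
      push_cast
      rw [C_add]
      ring
    refine ⟨?_, t⟩
    have h1' : ∑ i ∈ Finset.range (k + 2),
        C ((Nat.choose (k + i) (2 * i) : ℤ)) * X ^ (2 * i) = fibPoly (2 * k + 1) := by
      rw [Finset.sum_range_succ, h1, Nat.choose_eq_zero_of_lt (by omega)]
      simp
    rw [e1, ← t, ← h1', Finset.sum_range_succ', Finset.sum_range_succ' _ (k + 1),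
      Finset.mul_sum, ← add_assoc, ← Finset.sum_add_distrib]
    congr 1
    · refine Finset.sum_congr rfl fun i _ => ?_
      rw [show k + 1 + (i + 1) = (k + 1 + i) + 1 by ring,
        show 2 * (i + 1) = (2 * i + 1) + 1 by ring, Nat.choose_succ_succ',
        show k + (i + 1) = k + 1 + i by ring]
      push_cast
      rw [C_add]
      ring
    · simp

/-- `∑_{i=0}^{k} C(k+i, 2i) x^{2i} = F_{2k+1}(x)` in `ℤ[x]`. -/
theorem fibPoly_odd_expansion_int (k : ℕ) :
    ∑ i ∈ Finset.range (k + 1), C ((Nat.choose (k + i) (2 * i) : ℤ)) * X ^ (2 * i) =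
      fibPoly (2 * k + 1) := by
  exact (fibPoly_expansion_aux k).1
end

section
/- For every integer k ≥ 0, the following three identities hold in ℚ: (1) ∑_{i=0}^{k} C(k+i, 2i)/(2i+1) = L_{2k+1}/(2k+1); (2) ∑_{i=0}^{k} (-5)^i · C(k+i, 2i)/(2i+1) = (-1)^k · F_{2k+1}/(2k+1); (3) ∑_{i=0}^{k} (-5)^i · C(k+i, 2i) = (-1)^k · L_{2k+1}. -/
/-- Even binomial sum. -/
def sumB (x : ℚ) (k : ℕ) : ℚ := ∑ i ∈ Finset.range (k + 1), x ^ i * (Nat.choose (k + i) (2 * i) : ℚ)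

/-- Odd binomial sum. -/
def sumD (x : ℚ) (k : ℕ) : ℚ :=
  ∑ i ∈ Finset.range (k + 1), x ^ i * (Nat.choose (k + i) (2 * i + 1) : ℚ)

lemma sumD_succ (x : ℚ) (k : ℕ) : sumD x (k + 1) = sumB x k + sumD x k := by
  unfold sumD sumB
  rw [Finset.sum_range_succ, Nat.choose_eq_zero_of_lt (by omega : k + 1 + (k + 1) < 2 * (k + 1) + 1),
    ← Finset.sum_add_distrib]
  simp only [Nat.cast_zero, mul_zero, add_zero]
  refine Finset.sum_congr rfl fun i _ => ?_
  rw [show k + 1 + i = (k + i) + 1 by ring, Nat.choose_succ_succ]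
  push_cast
  ring

lemma sumB_succ (x : ℚ) (k : ℕ) : sumB x (k + 1) = sumB x k + x * sumD x (k + 1) := by
  have hB : sumB x k = ∑ i ∈ Finset.range (k + 1 + 1), x ^ i * (Nat.choose (k + i) (2 * i) : ℚ) := by
    rw [Finset.sum_range_succ, Nat.choose_eq_zero_of_lt (by omega : k + (k + 1) < 2 * (k + 1))]
    simp [sumB]
  have hD : sumD x (k + 1) =
      ∑ i ∈ Finset.range (k + 1), x ^ i * (Nat.choose (k + 1 + i) (2 * i + 1) : ℚ) := by
    unfold sumD
    rw [Finset.sum_range_succ,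
      Nat.choose_eq_zero_of_lt (by omega : k + 1 + (k + 1) < 2 * (k + 1) + 1)]
    simp
  rw [hB, hD]
  unfold sumB
  rw [Finset.sum_range_succ', Finset.sum_range_succ' _ (k + 1), Finset.mul_sum,
    add_right_comm (∑ j ∈ Finset.range (k + 1), _), ← Finset.sum_add_distrib]
  simp only [mul_zero, Nat.choose_zero_right]
  congr 1
  refine Finset.sum_congr rfl fun i _ => ?_
  rw [show k + 1 + (i + 1) = (k + 1 + i) + 1 by ring, show 2 * (i + 1) = (2 * i + 1) + 1 by ring,
    Nat.choose_succ_succ, show k + (i + 1) = k + 1 + i by ring]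
  push_cast
  ring

lemma lucas_succ_eq (n : ℕ) :
    lucas (n + 1) = Nat.fib (n + 1) + 2 * Nat.fib n ∧
      lucas (n + 2) = Nat.fib (n + 2) + 2 * Nat.fib (n + 1) := by
  induction n with
  | zero => simp [lucas]
  | succ n ih =>
    refine ⟨ih.2, ?_⟩
    rw [lucas, ih.1, ih.2, Nat.fib_add_two (n := n + 1), Nat.fib_add_two (n := n)]
    ring

lemma sum_one (k : ℕ) : sumB 1 k = Nat.fib (2 * k + 1) ∧ sumD 1 k = Nat.fib (2 * k) := by
  induction k with
  | zero => simp [sumB, sumD]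
  | succ k ih =>
    have h1 : Nat.fib (2 * (k + 1)) = Nat.fib (2 * k) + Nat.fib (2 * k + 1) := Nat.fib_add_two
    have h2 : Nat.fib (2 * (k + 1) + 1) = Nat.fib (2 * k + 1) + Nat.fib (2 * (k + 1)) :=
      Nat.fib_add_two
    rw [sumB_succ, sumD_succ, ih.1, ih.2, h2, h1]
    push_cast
    constructor <;> ring

lemma sum_neg_five (k : ℕ) :
    sumB (-5) k = (-1) ^ k * (Nat.fib (2 * k + 1) + 2 * Nat.fib (2 * k)) ∧
      sumD (-5) k = - (-1) ^ k * Nat.fib (2 * k) := by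
  induction k with
  | zero => simp [sumB, sumD]
  | succ k ih =>
    have h1 : Nat.fib (2 * (k + 1)) = Nat.fib (2 * k) + Nat.fib (2 * k + 1) := Nat.fib_add_two
    have h2 : Nat.fib (2 * (k + 1) + 1) = Nat.fib (2 * k + 1) + Nat.fib (2 * (k + 1)) :=
      Nat.fib_add_two
    rw [sumB_succ, sumD_succ, ih.1, ih.2, h2, h1]
    push_cast
    constructor <;> ring

lemma sum_div (x : ℚ) (k : ℕ) :
    ∑ i ∈ Finset.range (k + 1), x ^ i * (Nat.choose (k + i) (2 * i) : ℚ) / (2 * i + 1) =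
      (sumB x k + 2 * sumD x k) / (2 * k + 1) := by
  unfold sumB sumD
  rw [Finset.mul_sum, ← Finset.sum_add_distrib, Finset.sum_div]
  refine Finset.sum_congr rfl fun i hi => ?_
  have hik : i ≤ k := by
    have := Finset.mem_range.1 hi
    omega
  have h := Nat.choose_succ_right_eq (k + i) (2 * i)
  rw [show k + i - 2 * i = k - i by omega] at h
  have h' : (Nat.choose (k + i) (2 * i + 1) : ℚ) * (2 * i + 1)
      = Nat.choose (k + i) (2 * i) * (k - i) := by
    have := congrArg (Nat.cast : ℕ → ℚ) h
    push_cast [Nat.cast_sub hik] at this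
    exact this
  have p1 : (2 * (i : ℚ) + 1) ≠ 0 := by positivity
  have p2 : (2 * (k : ℚ) + 1) ≠ 0 := by positivity
  rw [div_eq_div_iff p1 p2]
  linear_combination (-2 * x ^ i) * h'

/-- Three identities in `ℚ`: for every `k ≥ 0`,
`∑_{i=0}^{k} C(k+i,2i)/(2i+1) = L_{2k+1}/(2k+1)`,
`∑_{i=0}^{k} (-5)^i C(k+i,2i)/(2i+1) = (-1)^k F_{2k+1}/(2k+1)`, and
`∑_{i=0}^{k} (-5)^i C(k+i,2i) = (-1)^k L_{2k+1}`. -/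
theorem three_number_identities (k : ℕ) :
    (∑ i ∈ Finset.range (k + 1), (Nat.choose (k + i) (2 * i) : ℚ) / (2 * i + 1) =
        (lucas (2 * k + 1) : ℚ) / (2 * k + 1)) ∧
      (∑ i ∈ Finset.range (k + 1),
          (-5 : ℚ) ^ i * (Nat.choose (k + i) (2 * i)) / (2 * i + 1) =
        (-1 : ℚ) ^ k * (Nat.fib (2 * k + 1) : ℚ) / (2 * k + 1)) ∧
      (∑ i ∈ Finset.range (k + 1), (-5 : ℚ) ^ i * (Nat.choose (k + i) (2 * i)) =
        (-1 : ℚ) ^ k * (lucas (2 * k + 1) : ℚ)) := by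
  have hL : (lucas (2 * k + 1) : ℚ) = Nat.fib (2 * k + 1) + 2 * Nat.fib (2 * k) := by
    exact_mod_cast (lucas_succ_eq (2 * k)).1
  refine ⟨?_, ?_, ?_⟩
  · have h := sum_div 1 k
    simp only [one_pow, one_mul] at h
    rw [h, (sum_one k).1, (sum_one k).2, hL]
  · rw [sum_div, (sum_neg_five k).1, (sum_neg_five k).2]
    ring
  · rw [hL]
    exact (sum_neg_five k).1
end

section
/- For every integer k ≥ 0 and all complex numbers w, z with w^2 = -(z^2 + 4), one has z · F_{2k+1}(w) = (-1)^k · L_{2k+1}(z), where F_{2k+1} and L_{2k+1} are the Fibonacci and Lucas polynomials regarded as functions ℂ → ℂ. (This is the evaluation F_{2k+1}(I√(x^2+4)) = (-1)^k L_{2k+1}(x)/x used in the paper; it is well-defined since F_{2k+1} is an even polynomial.) -/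
open Polynomial

/-- If `w^2 = -(z^2 + 4)` then `z F_{2k+1}(w) = (-1)^k L_{2k+1}(z)`. -/
theorem fib_lucas_evaluation (k : ℕ) (w z : ℂ) (h : w ^ 2 = -(z ^ 2 + 4)) :
    z * (aeval w (fibPoly (2 * k + 1)) : ℂ) =
      (-1 : ℂ) ^ k * (aeval z (lucasPoly (2 * k + 1)) : ℂ) := by
  have hF : ∀ n, (aeval w (fibPoly (n + 2)) : ℂ) =
      w * aeval w (fibPoly (n + 1)) + aeval w (fibPoly n) := by
    intro n
    simp [fibPoly]
  have hL : ∀ n, (aeval z (lucasPoly (n + 2)) : ℂ) =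
      z * aeval z (lucasPoly (n + 1)) + aeval z (lucasPoly n) := by
    intro n
    simp [lucasPoly]
  induction k using Nat.twoStepInduction with
  | zero => simp [fibPoly, lucasPoly]
  | one =>
    have h2 : (aeval z (2 : Polynomial ℤ) : ℂ) = 2 := map_ofNat _ 2
    simp [fibPoly, lucasPoly, h2]
    linear_combination z * h
  | more k ih0 ih1 =>
    have a1 := hF (2 * k + 1)
    have a2 := hF (2 * k + 2)
    have a3 := hF (2 * k + 3)
    have b1 := hL (2 * k + 1)
    have b2 := hL (2 * k + 2)
    have b3 := hL (2 * k + 3)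
    have e : 2 * (k + 1) + 1 = 2 * k + 3 := by ring
    have e' : 2 * (k + 2) + 1 = 2 * k + 5 := by ring
    rw [e] at ih1
    rw [e']
    simp only [Nat.add_assoc, Nat.reduceAdd] at a1 a2 a3 b1 b2 b3
    have f : (aeval w (fibPoly (2 * k + 5)) : ℂ) =
        (w ^ 2 + 2) * aeval w (fibPoly (2 * k + 3)) - aeval w (fibPoly (2 * k + 1)) := by
      linear_combination a3 + w * a2 - a1
    have l : (aeval z (lucasPoly (2 * k + 5)) : ℂ) =
        (z ^ 2 + 2) * aeval z (lucasPoly (2 * k + 3)) - aeval z (lucasPoly (2 * k + 1)) := by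
      linear_combination b3 + z * b2 - b1
    rw [f, l, h]
    rw [pow_succ] at ih1
    rw [pow_succ, pow_succ]
    linear_combination (-(z ^ 2 + 2)) * ih1 - ih0
end

section
/- For every positive integer m, the polynomial S_{2m+1}(x) with rational coefficients defined by S_{2m+1}(x) = ∑_{s=0}^{m} x^{2s+1} ( ∑_{k=s}^{m} ((1+2k)/(1+2s)) · C(2m+1, m-k) · C(k+s, 2s) · (-5)^{s-m} / L_{2k+1} ) − ∑_{k=0}^{m} (-1)^{m-k} · C(2m+1, m-k) · (F_{2k+1} / L_{2k+1}) · 5^{-m} satisfies S_{2m+1}(1) = 0 and S_{2m+1}'(1) = 0; consequently (x-1)^2 divides S_{2m+1}(x) in ℚ[x]. -/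
open Polynomial

lemma bd_sums (k : ℕ) :
    (∑ s ∈ Finset.range (k + 1), ((k + s).choose (2 * s) : ℚ) * (-5) ^ s
      = (-1) ^ k * lucas (2 * k + 1)) ∧
    (∑ s ∈ Finset.range (k + 1), ((k + s + 1).choose (2 * s + 1) : ℚ) * (-5) ^ s
      = (-1) ^ k * Nat.fib (2 * k + 2)) := by
  have hL : ∀ n, lucas (n + 1) = Nat.fib (n + 2) + Nat.fib n := by
    intro n
    induction n using Nat.twoStepInduction with
    | zero => simp [lucas]
    | one => simp [lucas, Nat.fib_add_two]
    | more n h1 h2 =>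
      have e : lucas (n + 2 + 1) = lucas (n + 1 + 1) + lucas (n + 1) := by rw [lucas]
      rw [e, h1, h2]
      have := Nat.fib_add_two (n := n)
      have := Nat.fib_add_two (n := n + 1)
      have := Nat.fib_add_two (n := n + 2)
      simp only [Nat.add_assoc, Nat.reduceAdd] at *
      omega
  induction k with
  | zero => simp [lucas]
  | succ k ih =>
    obtain ⟨ihB, ihD⟩ := ih
    have f1 : (Nat.fib (2 * k + 2) : ℚ) = Nat.fib (2 * k) + Nat.fib (2 * k + 1) := by
      exact_mod_cast Nat.fib_add_two (n := 2 * k)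
    have f2 : (Nat.fib (2 * k + 3) : ℚ) = Nat.fib (2 * k + 1) + Nat.fib (2 * k + 2) := by
      exact_mod_cast Nat.fib_add_two (n := 2 * k + 1)
    have f3 : (Nat.fib (2 * k + 4) : ℚ) = Nat.fib (2 * k + 2) + Nat.fib (2 * k + 3) := by
      exact_mod_cast Nat.fib_add_two (n := 2 * k + 2)
    have l1 : (lucas (2 * k + 1) : ℚ) = Nat.fib (2 * k + 2) + Nat.fib (2 * k) := by
      exact_mod_cast hL (2 * k)
    have l3 : (lucas (2 * k + 3) : ℚ) = Nat.fib (2 * k + 4) + Nat.fib (2 * k + 2) := by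
      exact_mod_cast hL (2 * k + 2)
    have hB : ∑ s ∈ Finset.range (k + 1 + 1), ((k + 1 + s).choose (2 * s) : ℚ) * (-5) ^ s
        = (-1) ^ (k + 1) * lucas (2 * k + 3) := by
      have e1 : ∑ s ∈ Finset.range (k + 1 + 1), ((k + s).choose (2 * s) : ℚ) * (-5) ^ s
          = (-1) ^ k * lucas (2 * k + 1) := by
        rw [Finset.sum_range_succ, ihB, Nat.choose_eq_zero_of_lt (by omega)]
        simp
      have e2 : ∑ s ∈ Finset.range (k + 1 + 1), ((k + 1 + s).choose (2 * s) : ℚ) * (-5) ^ s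
          = ∑ s ∈ Finset.range (k + 1 + 1), ((k + s).choose (2 * s) : ℚ) * (-5) ^ s
          + (-5) * ∑ s ∈ Finset.range (k + 1), ((k + s + 1).choose (2 * s + 1) : ℚ) * (-5) ^ s := by
        rw [Finset.sum_range_succ', Finset.sum_range_succ' _ (k + 1), Finset.mul_sum]
        conv_rhs => rw [add_right_comm, ← Finset.sum_add_distrib]
        congr 1
        · apply Finset.sum_congr rfl
          intro s _
          have : (k + 1 + (s + 1)).choose (2 * (s + 1))
              = (k + s + 1).choose (2 * s + 1) + (k + (s + 1)).choose (2 * (s + 1)) := by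
            rw [show k + 1 + (s + 1) = (k + s + 1) + 1 by ring,
              show 2 * (s + 1) = (2 * s + 1) + 1 by ring, Nat.choose_succ_succ]
            rfl
          rw [this]
          push_cast
          ring
        · simp
      rw [e2, e1, ihD, l1, l3, f3, f2, f1]
      ring
    refine ⟨hB, ?_⟩
    have e1 : ∑ s ∈ Finset.range (k + 1 + 1), ((k + s + 1).choose (2 * s + 1) : ℚ) * (-5) ^ s
        = (-1) ^ k * Nat.fib (2 * k + 2) := by
      rw [Finset.sum_range_succ, ihD, Nat.choose_eq_zero_of_lt (by omega)]
      simp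
    have e2 : ∑ s ∈ Finset.range (k + 1 + 1), ((k + 1 + s + 1).choose (2 * s + 1) : ℚ) * (-5) ^ s
        = ∑ s ∈ Finset.range (k + 1 + 1), ((k + 1 + s).choose (2 * s) : ℚ) * (-5) ^ s
        + ∑ s ∈ Finset.range (k + 1 + 1), ((k + s + 1).choose (2 * s + 1) : ℚ) * (-5) ^ s := by
      rw [← Finset.sum_add_distrib]
      apply Finset.sum_congr rfl
      intro s _
      rw [Nat.choose_succ_succ, show k + s + 1 = k + 1 + s by ring]
      push_cast
      ring
    rw [e2, e1, hB, l3, show 2 * (k + 1) + 2 = 2 * k + 4 by ring, f3, f2, f1]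
    ring

lemma a_sum (k : ℕ) :
    ∑ s ∈ Finset.range (k + 1), ((1 + 2 * k : ℚ) / (1 + 2 * s)) *
      ((k + s).choose (2 * s) : ℚ) * (-5) ^ s = (-1) ^ k * Nat.fib (2 * k + 1) := by
  obtain ⟨hB, hD⟩ := bd_sums k
  have e : ∑ s ∈ Finset.range (k + 1), ((1 + 2 * k : ℚ) / (1 + 2 * s)) *
      ((k + s).choose (2 * s) : ℚ) * (-5) ^ s
      = 2 * ∑ s ∈ Finset.range (k + 1), ((k + s + 1).choose (2 * s + 1) : ℚ) * (-5) ^ s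
      - ∑ s ∈ Finset.range (k + 1), ((k + s).choose (2 * s) : ℚ) * (-5) ^ s := by
    rw [Finset.mul_sum, ← Finset.sum_sub_distrib]
    apply Finset.sum_congr rfl
    intro s _
    have h := Nat.add_one_mul_choose_eq (k + s) (2 * s)
    have h' : ((k : ℚ) + s + 1) * ((k + s).choose (2 * s) : ℚ)
        = ((k + s + 1).choose (2 * s + 1) : ℚ) * (2 * s + 1) := by exact_mod_cast h
    have hp : (1 + 2 * (s : ℚ)) ≠ 0 := by positivity
    field_simp
    linear_combination 2 * h'
  have f1 : (Nat.fib (2 * k + 2) : ℚ) = Nat.fib (2 * k) + Nat.fib (2 * k + 1) := by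
    exact_mod_cast Nat.fib_add_two (n := 2 * k)
  have l1 : (lucas (2 * k + 1) : ℚ) = Nat.fib (2 * k + 1) + 2 * Nat.fib (2 * k) := by
    have : ∀ n, lucas (n + 1) = Nat.fib (n + 1) + 2 * Nat.fib n := by
      intro n
      induction n using Nat.twoStepInduction with
      | zero => simp [lucas]
      | one => simp [lucas]
      | more n h1 h2 =>
        have e : lucas (n + 2 + 1) = lucas (n + 1 + 1) + lucas (n + 1) := by rw [lucas]
        rw [e, h1, h2]
        have := Nat.fib_add_two (n := n)
        have := Nat.fib_add_two (n := n + 1)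
        simp only [Nat.add_assoc, Nat.reduceAdd] at *
        omega
    exact_mod_cast this (2 * k)
  rw [e, hB, hD, f1, l1]
  ring

lemma alt_partial (n J : ℕ) :
    ∑ j ∈ Finset.range (J + 2), (-1 : ℚ) ^ j * ((n : ℚ) + 2 - 2 * j) * ((n + 2).choose j : ℚ)
      = ((n : ℚ) + 2) * (-1) ^ (J + 1) * ((n.choose (J + 1) : ℚ) - n.choose J) := by
  induction J with
  | zero => 
    simp [Finset.sum_range_succ]
    ring
  | succ J ih =>
    rw [Finset.sum_range_succ, ih]
    have h1 : ((n : ℚ) + 1 + 1) * ((n + 1).choose (J + 1) : ℚ)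
        = ((n + 1 + 1).choose (J + 1 + 1) : ℚ) * (J + 1 + 1) := by
      exact_mod_cast Nat.add_one_mul_choose_eq (n + 1) (J + 1)
    have p1 : ((n + 1 + 1).choose (J + 1 + 1) : ℚ)
        = (n + 1).choose (J + 1) + (n + 1).choose (J + 1 + 1) := by
      exact_mod_cast Nat.choose_succ_succ (n + 1) (J + 1)
    have p2 : ((n + 1).choose (J + 1) : ℚ) = n.choose J + n.choose (J + 1) := by
      exact_mod_cast Nat.choose_succ_succ n J
    have p3 : ((n + 1).choose (J + 1 + 1) : ℚ) = n.choose (J + 1) + n.choose (J + 1 + 1) := by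
      exact_mod_cast Nat.choose_succ_succ n (J + 1)
    rw [show J + 2 = J + 1 + 1 by rfl, show n + 2 = n + 1 + 1 by rfl]
    push_cast
    rw [pow_succ (-1 : ℚ) (J + 1)]
    linear_combination (-1 : ℚ) ^ (J + 1) * (-2 * h1 - (n + 2) * p1 + (n + 2) * p2 - (n + 2) * p3)

lemma alt_zero (m : ℕ) (hm : 0 < m) :
    ∑ k ∈ Finset.range (m + 1), (-1 : ℚ) ^ k * (1 + 2 * k) * ((2 * m + 1).choose (m - k) : ℚ)
      = 0 := by
  obtain ⟨p, rfl⟩ : ∃ p, m = p + 1 := ⟨m - 1, by omega⟩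
  have h := alt_partial (2 * p + 1) p
  have hs : (2 * p + 1).choose (p + 1) = (2 * p + 1).choose p :=
    Nat.choose_symm_of_eq_add (by ring)
  rw [hs, sub_self, mul_zero] at h
  rw [← Finset.sum_range_reflect]
  have : (-1 : ℚ) ^ (p + 1) * 0 = 0 := by simp
  rw [← this, ← h, Finset.mul_sum]
  apply Finset.sum_congr rfl
  intro j hj
  have hj' : j ≤ p + 1 := by simp at hj; omega
  obtain ⟨i, hi⟩ := Nat.exists_eq_add_of_le hj'
  have e1 : p + 1 + 1 - 1 - j = i := by omega
  have e2 : p + 1 - i = j := by omega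
  have hq : (p : ℚ) + 1 = j + i := by exact_mod_cast hi
  rw [e1, e2, hi, pow_add]
  have hsq : (-1 : ℚ) ^ j * (-1) ^ j = 1 := by rw [← mul_pow]; simp
  rw [show 2 * (j + i) + 1 = 2 * p + 1 + 2 by omega]
  push_cast
  have hp : (p : ℚ) = j + i - 1 := by linarith
  rw [hp]
  linear_combination (-(1 + 2 * (i : ℚ)) * (-1) ^ i * ((2 * p + 1 + 2).choose j : ℚ)) * hsq

lemma lucas_ne (n : ℕ) : (lucas n : ℚ) ≠ 0 := by
  have : 0 < lucas n := by
    induction n using Nat.twoStepInduction with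
    | zero => simp [lucas]
    | one => simp [lucas]
    | more n h1 h2 => rw [lucas]; omega
  exact_mod_cast this.ne'

lemma zp (s m : ℕ) : (-5 : ℚ) ^ ((s : ℤ) - (m : ℤ)) = (-5) ^ s * ((-5) ^ m)⁻¹ := by
  rw [zpow_sub₀ (by norm_num)]
  simp [div_eq_mul_inv]

lemma swap_sum (m : ℕ) (f : ℕ → ℕ → ℚ) :
    ∑ s ∈ Finset.range (m + 1), ∑ k ∈ Finset.Icc s m, f s k
      = ∑ k ∈ Finset.range (m + 1), ∑ s ∈ Finset.range (k + 1), f s k := by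
  apply Finset.sum_comm'
  intro x y
  simp only [Finset.mem_range, Finset.mem_Icc]
  omega

lemma eval_zero (m : ℕ) : (ozekiProdinger m).eval 1 = 0 := by
  unfold ozekiProdinger
  simp only [eval_sub, eval_finsetSum, eval_mul, eval_C, eval_pow, eval_X, one_pow, mul_one]
  rw [swap_sum, sub_eq_zero]
  apply Finset.sum_congr rfl
  intro k hk
  have hk' : k ≤ m := by simp at hk; omega
  obtain ⟨i, rfl⟩ := Nat.exists_eq_add_of_le hk'
  have ha := a_sum k
  set c : ℚ := ((2 * (k + i) + 1).choose (k + i - k) : ℚ) * ((-5) ^ (k + i))⁻¹ /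
    (lucas (2 * k + 1)) with hc
  trans c * ((-1) ^ k * Nat.fib (2 * k + 1))
  · rw [← ha, Finset.mul_sum]
    apply Finset.sum_congr rfl
    intro s _
    rw [zp, hc]
    ring
  · rw [hc, zpow_neg, zpow_natCast, Nat.add_sub_cancel_left]
    have : (-5 : ℚ) ^ (k + i) = (-1) ^ k * (-1) ^ i * 5 ^ (k + i) := by
      rw [← pow_add, ← mul_pow]; norm_num
    rw [this]
    have h1 : (-1 : ℚ) ^ k * (-1) ^ k = 1 := by rw [← mul_pow]; simp
    have h2 : (-1 : ℚ) ^ i * (-1) ^ i = 1 := by rw [← mul_pow]; simp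
    have h3 : ((-1 : ℚ) ^ k)⁻¹ = (-1) ^ k := inv_eq_of_mul_eq_one_left h1
    have h4 : ((-1 : ℚ) ^ i)⁻¹ = (-1) ^ i := inv_eq_of_mul_eq_one_left h2
    rw [mul_inv, mul_inv, h3, h4]
    linear_combination (((2 * (k + i) + 1).choose i : ℚ) * (-1) ^ i * (5 ^ (k + i))⁻¹ /
      (lucas (2 * k + 1)) * Nat.fib (2 * k + 1)) * h1

lemma oz_derivative_eval (m : ℕ) (hm : 0 < m) : ((ozekiProdinger m).derivative).eval 1 = 0 := by
  unfold ozekiProdinger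
  simp only [derivative_sub, derivative_sum, derivative_C_mul, derivative_X_pow, derivative_C,
    sub_zero, eval_finsetSum, eval_mul, eval_C, eval_pow, eval_X, one_pow, mul_one,
    Finset.sum_mul]
  rw [swap_sum]
  have h := alt_zero m hm
  have : ((-5 : ℚ) ^ m)⁻¹ * 0 = 0 := by simp
  rw [← this, ← h, Finset.mul_sum]
  apply Finset.sum_congr rfl
  intro k _
  have hb := (bd_sums k).1
  have hl := lucas_ne (2 * k + 1)
  trans (((-5 : ℚ) ^ m)⁻¹ * (1 + 2 * k) * ((2 * m + 1).choose (m - k) : ℚ) / lucas (2 * k + 1)) *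
    ((-1) ^ k * lucas (2 * k + 1))
  · rw [← hb, Finset.mul_sum]
    apply Finset.sum_congr rfl
    intro s _
    rw [zp]
    have hp : (1 + 2 * (s : ℚ)) ≠ 0 := by positivity
    push_cast
    field_simp
    ring
  · field_simp

/-- For every positive integer `m`, the polynomial `S_{2m+1}(x)` and its derivative both
vanish at `1`; consequently `(x-1)^2` divides `S_{2m+1}(x)` in `ℚ[x]`. -/
theorem factor_x_minus_one_sq (m : ℕ) (hm : 0 < m) :
    (ozekiProdinger m).eval 1 = 0 ∧ ((ozekiProdinger m).derivative).eval 1 = 0 ∧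
      (X - 1) ^ 2 ∣ ozekiProdinger m := by
  have h0 := eval_zero m
  have h1 := oz_derivative_eval m hm
  refine ⟨h0, h1, ?_⟩
  obtain ⟨q, hq⟩ := dvd_iff_isRoot.mpr h0
  rw [hq] at h1
  simp at h1
  obtain ⟨r, hr⟩ := dvd_iff_isRoot.mpr h1
  refine ⟨r, ?_⟩
  rw [hq, hr, C_1]
  ring
end
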